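/- For every semifinite zigzag growth model (t,w), the function φ_{t,w} is a strictly positive, semifinite, indecomposable harmonic function on the graph Z(t). -/

import Mathlib

/-!
Common definitions: the zigzag graph on binary words, templates and their coideals,
zigzag flanges and sections, the functions `F_λ(u)` and `φ_{t,w}`, and harmonic /
semifinite / indecomposable functions on subgraphs of the zigzag graph.
-/

open scoped ENNReal NNReal

namespace Zigzag

/-- Binary words: `true` is `+`, `false` is `−`. -/
abbrev BW := List Bool

/-- `CoveredBy a b`: `b` covers `a` in the subword order, i.e. `|b| = |a| + 1` and `a`
is a subword of `b`; these are the edges of the zigzag graph. -/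
def CoveredBy (a b : BW) : Prop := a.Sublist b ∧ b.length = a.length + 1

/-- The set of upper neighbours of `a` lying in `S` is finite. -/
lemma upSet_finite (S : Set BW) (a : BW) : {b | b ∈ S ∧ CoveredBy a b}.Finite :=
  (List.finite_length_eq Bool (a.length + 1)).subset (fun _ hb => hb.2.2)

/-- The finset of upper neighbours of `a` inside `S`. -/
noncomputable def upFinset (S : Set BW) (a : BW) : Finset BW :=
  (upSet_finite S a).toFinset

/-- A `[0,∞]`-valued function is harmonic on `S ⊆ Z` (with the edges induced from the
zigzag graph) if its value at any vertex of `S` equals the sum of its values at the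
upper neighbours lying in `S`. -/
def HarmonicOn (S : Set BW) (φ : BW → ℝ≥0∞) : Prop :=
  ∀ a ∈ S, φ a = ∑ b ∈ upFinset S a, φ b

/-- A template: a nonempty sequence of clusters with alternating signs, each cluster
being a sign (`true` = `+`, `false` = `−`) with a multiplicity in `{1,2,…} ∪ {∞}`,
containing at least one infinite cluster. -/
structure Template where
  clusters : List (Bool × ℕ∞)
  ne : clusters ≠ []
  pos : ∀ c ∈ clusters, c.2 ≠ 0
  alternating : clusters.Chain' fun c d => c.1 ≠ d.1
  hasInf : ∃ c ∈ clusters, c.2 = ⊤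

/-- The binary word obtained from a list of clusters by replacing every infinite
multiplicity by `N` (and keeping the finite multiplicities). -/
def clWord (cs : List (Bool × ℕ∞)) (N : ℕ) : BW :=
  (cs.map fun c => List.replicate (if c.2 = ⊤ then N else c.2.toNat) c.1).flatten

/-- The coideal generated by a list of clusters: all binary words that are subwords of
some instantiation. -/
def Zcl (cs : List (Bool × ℕ∞)) : Set BW := {a | ∃ N, a.Sublist (clWord cs N)}

/-- The coideal `Z(t)` of the zigzag graph attached to a template `t`. -/
def Zt (t : Template) : Set BW := Zcl t.clusters

/-- The cluster in position `i` of `t` is a separating cluster: a one-symbol finite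
cluster which is not outermost and whose two neighbours are infinite clusters
(necessarily of the same sign). -/
def Template.isSep (t : Template) (i : ℕ) : Prop :=
  0 < i ∧ i + 1 < t.clusters.length ∧
  (t.clusters.getD i (true, 1)).2 = 1 ∧
  (t.clusters.getD (i - 1) (true, 1)).2 = ⊤ ∧
  (t.clusters.getD (i + 1) (true, 1)).2 = ⊤

/-- A template is finite if all its finite clusters are separating; otherwise it is
semifinite. -/
def Template.IsFiniteTemplate (t : Template) : Prop :=
  ∀ i < t.clusters.length, (t.clusters.getD i (true, 1)).2 ≠ ⊤ → t.isSep i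

/-- The number of infinite clusters of a template. -/
def Template.numInf (t : Template) : ℕ :=
  (t.clusters.filter fun c => decide (c.2 = ⊤)).length

/-- Position `p` of `t` carries a finite non-separating cluster, i.e. a cluster
contributing to the zigzag flange of `t`. -/
def IsFlangePos (t : Template) (p : ℕ) : Prop :=
  p < t.clusters.length ∧ (t.clusters.getD p (true, 1)).2 ≠ ⊤ ∧ ¬t.isSep p

/-- Decrease by one the multiplicity of the cluster in position `p`. -/
def decAt (cs : List (Bool × ℕ∞)) (p : ℕ) : List (Bool × ℕ∞) :=
  cs.set p ((cs.getD p (true, 1)).1, (cs.getD p (true, 1)).2 - 1)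

/-- The coideal `J(t)`: the union of the coideals `Z(r)` over all `r` obtained from `t`
by removing a single symbol from a cluster corresponding to a block of a binary word
from the zigzag flange of `t` (no merging of clusters is needed to generate `Z(r)`). -/
def Jt (t : Template) : Set BW :=
  {a | ∃ p, IsFlangePos t p ∧ a ∈ Zcl (decAt t.clusters p)}

/-- The canonical splitting of a template `t` into its zigzag flange
`fl(t) = (a₀, …, a_k)` (given by the lists `A 0, …, A k` of clusters, each consisting
of finite non-separating clusters of `t`) and its sections `t₁, …, t_k` (the maximal
groups of consecutive clusters forming finite templates), so that
`t = (a₀, t₁, a₁, …, a_{k−1}, t_k, a_k)`.  The two `interior` conditions express the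
maximality of the decomposition. -/
structure SectionData (t : Template) where
  k : ℕ
  A : Fin (k + 1) → List (Bool × ℕ∞)
  T : Fin k → Template
  concat : t.clusters
      = A 0 ++ (List.ofFn fun i : Fin k => (T i).clusters ++ A i.succ).flatten
  finA : ∀ j, ∀ c ∈ A j, c.2 ≠ ⊤
  secFin : ∀ i, (T i).IsFiniteTemplate
  interior_ne : ∀ j : Fin (k + 1), (j : ℕ) ≠ 0 → (j : ℕ) ≠ k → A j ≠ []
  interior_not_sep : ∀ j : Fin (k + 1), (j : ℕ) ≠ 0 → (j : ℕ) ≠ k →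
      ∀ s : Bool, A j ≠ [(s, 1)]

/-- The binary word corresponding to a list of finite clusters (a flange word). -/
def flangeWord (cs : List (Bool × ℕ∞)) : BW :=
  (cs.map fun c => List.replicate c.2.toNat c.1).flatten

/-- `a₀ ⊔ ℓ 1 ⊔ a₁ ⊔ … ⊔ ℓ k ⊔ a_k` (empty flange words disappear). -/
def assemble {t : Template} (D : SectionData t) (ℓ : Fin D.k → BW) : BW :=
  flangeWord (D.A 0) ++ (List.ofFn fun i : Fin D.k => ℓ i ++ flangeWord (D.A i.succ)).flatten

/-- `ℓ` is a decomposition of `a` along the sections of `t`: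
`bw(a) = a₀ ⊔ bw(ℓ 1) ⊔ a₁ ⊔ … ⊔ bw(ℓ k) ⊔ a_k` with `ℓ i ∈ Z(tᵢ)`. -/
def decompOf {t : Template} (D : SectionData t) (a : BW) (ℓ : Fin D.k → BW) : Prop :=
  (∀ i, ℓ i ∈ Zt (D.T i)) ∧ a = assemble D ℓ

/-- The signs of the infinite clusters of a list of clusters, in order. -/
def infSigns (cs : List (Bool × ℕ∞)) : List Bool :=
  (cs.filter fun c => decide (c.2 = ⊤)).map Prod.fst

/-- The number of weights consumed by the sections preceding the `i`-th one. -/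
def secOffset {t : Template} (D : SectionData t) (i : Fin D.k) : ℕ :=
  ∑ i' ∈ Finset.univ.filter (· < i), (infSigns (D.T i').clusters).length

/-- The part `vᵢ` of the tuple of weights `w` corresponding to the infinite clusters of
the `i`-th section, as a sequence of (sign, weight) pairs. -/
def vD {t : Template} (D : SectionData t) (w : List ℝ) (i : Fin D.k) : List (Bool × ℝ) :=
  (infSigns (D.T i).clusters).zip (w.drop (secOffset D i))

/-- `F_λ(u)` for a finite sequence `u` of (sign, length) pairs and a zigzag `λ`
(encoded by its binary word `a`, so that `λ` has `a.length + 1` boxes): the sum, over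
all decompositions of `λ` into `u.length` consecutive (possibly empty) zigzags
`λ(1), …, λ(m)` with `λ(i)` a row when the `i`-th sign is `+` and a column when it is
`−`, of `u₁ ^ |λ(1)| ⋯ u_m ^ |λ(m)|`.  A decomposition is recorded by the tuple `c` of
the numbers of boxes of the pieces; the row/column constraint says that the letters of
`a` strictly inside the `i`-th group of boxes all equal the `i`-th sign. -/
noncomputable def Fword (u : List (Bool × ℝ)) (a : BW) : ℝ :=
  ∑ c ∈ (Finset.Nat.antidiagonalTuple u.length (a.length + 1)).filter
      (fun c => ∀ i : Fin u.length,
        (a.drop (∑ i' ∈ Finset.univ.filter (· < i), c i')).take (c i - 1)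
          = List.replicate (c i - 1) (u.get i).1),
    ∏ i, (u.get i).2 ^ c i

open Classical in
/-- The function `φ_{t,w}` attached to a semifinite zigzag growth model `(t, w)`:
it equals `+∞` on `J(t)`, and on `Z(t) ∖ J(t)` it equals
`F_{λ^{(1)}}(v₁) ⋯ F_{λ^{(k)}}(v_k)`, where `(λ^{(1)}, …, λ^{(k)})` is the (unique)
decomposition of `λ` along the sections of `t` (it is `0` off `Z(t)`). -/
noncomputable def phiTW (t : Template) (D : SectionData t) (w : List ℝ) (a : BW) : ℝ≥0∞ :=
  if a ∉ Zt t then 0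
  else if a ∈ Jt t then ⊤
  else if h : ∃ ℓ : Fin D.k → BW, decompOf D a ℓ then
    ENNReal.ofReal (∏ i, Fword (vD D w i) (h.choose i))
  else 0

section Kcone

/-- The relation `λ = ∑_{μ : λ ↗ μ} μ` (within `S`) as an element of the free module. -/
noncomputable def relOf (S : Set BW) (a : BW) : BW →₀ ℝ :=
  Finsupp.single a 1 - ∑ b ∈ upFinset S a, Finsupp.single b 1

/-- The submodule of relations defining `K(S)`. -/
noncomputable def Krel (S : Set BW) : Submodule ℝ (BW →₀ ℝ) :=
  Submodule.span ℝ {f | ∃ a ∈ S, f = relOf S a}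

/-- The class of `f` in `K(S) = (⊕_{λ ∈ S} ℝ λ) ⧸ (relations)`. -/
noncomputable def kmk (S : Set BW) (f : BW →₀ ℝ) : (BW →₀ ℝ) ⧸ Krel S :=
  Submodule.Quotient.mk f

/-- Nonnegative formal combinations of vertices of `S`. -/
def NonnegOn (S : Set BW) (f : BW →₀ ℝ) : Prop :=
  (∀ x, 0 ≤ f x) ∧ ∀ x ∈ f.support, x ∈ S

/-- The cone `K⁺(S)` spanned by the vertices of `S` in `K(S)`. -/
noncomputable def Kpos (S : Set BW) : Set ((BW →₀ ℝ) ⧸ Krel S) :=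
  kmk S '' {f | NonnegOn S f}

/-- The order defined by the cone `K⁺(S)`: `x ≤_K y` iff `y − x ∈ K⁺(S)`. -/
def leK (S : Set BW) (x y : (BW →₀ ℝ) ⧸ Krel S) : Prop := y - x ∈ Kpos S

/-- The value of (the canonical extension of) `φ` at a nonnegative combination of
vertices. -/
noncomputable def phiHat (φ : BW → ℝ≥0∞) (f : BW →₀ ℝ) : ℝ≥0∞ :=
  ∑ x ∈ f.support, ENNReal.ofReal (f x) * φ x

/-- `φ` is finite on `S`. -/
def FiniteOn (S : Set BW) (φ : BW → ℝ≥0∞) : Prop := ∀ a ∈ S, φ a ≠ ⊤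

/-- `φ` is a semifinite function on (the graph) `S`: it is not everywhere finite, and
its value at any element `a` of the cone `K⁺` is the supremum of its values at the
elements `b ≤_K a` of the cone where it is finite. -/
def SemifiniteOn (S : Set BW) (φ : BW → ℝ≥0∞) : Prop :=
  (∃ a ∈ S, φ a = ⊤) ∧
  ∀ f : BW →₀ ℝ, NonnegOn S f →
    phiHat φ f =
      ⨆ g ∈ {g : BW →₀ ℝ |
        NonnegOn S g ∧ leK S (kmk S g) (kmk S f) ∧ phiHat φ g ≠ ⊤}, phiHat φ g

/-- A semifinite harmonic function `φ` on `S` is indecomposable if any finite or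
semifinite harmonic function `φ′ ≤ φ` on `S` which does not vanish identically on the
finiteness ideal of `φ` is a constant multiple of `φ` on that ideal. -/
def IndecSemifiniteOn (S : Set BW) (φ : BW → ℝ≥0∞) : Prop :=
  ∀ φ' : BW → ℝ≥0∞, HarmonicOn S φ' →
    (FiniteOn S φ' ∨ SemifiniteOn S φ') →
    (∀ a ∈ S, φ' a ≤ φ a) →
    (∃ a ∈ S, φ a ≠ ⊤ ∧ φ' a ≠ 0) →
    ∃ c : ℝ≥0, ∀ a ∈ S, φ a ≠ ⊤ → φ' a = (c : ℝ≥0∞) * φ a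

end Kcone

end Zigzag

namespace Zigzag

/-- The part of `F_a((ε, x) :: u)` in which the first group of boxes is nonempty; here `f a`
stands for `F_a(u)`. -/
def headSum (ε : Bool) (x : ℝ) (f : BW → ℝ) : BW → ℝ
  | [] => x
  | y :: a => x * (f a + if y = ε then headSum ε x f a else 0)

/-- Recursive form of `F_a(u)`. -/
def zigF : List (Bool × ℝ) → BW → ℝ
  | [], _ => 0
  | p :: u, a => zigF u a + headSum p.1 p.2 (zigF u) a

/-- The words covering a given word, listed without repetition. -/
def ups : BW → List BW
  | [] => [[true], [false]]
  | x :: a => ((!x) :: x :: a) :: (ups a).map (x :: ·)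

lemma mem_ups {a b : BW} : b ∈ ups a ↔ CoveredBy a b := by
  induction a generalizing b with
  | nil =>
    simp only [ups, CoveredBy, List.length_nil, zero_add, List.length_eq_one_iff, List.nil_sublist,
      true_and, List.mem_cons, List.not_mem_nil, or_false]
    constructor
    · rintro (rfl | rfl) <;> exact ⟨_, rfl⟩
    · rintro ⟨x, rfl⟩
      cases x <;> simp
  | cons x a ih =>
    simp only [ups, List.mem_cons, List.mem_map, ih, CoveredBy]
    constructor
    · rintro (rfl | ⟨b, ⟨h1, h2⟩, rfl⟩)
      · exact ⟨List.sublist_cons_self _ _, by simp⟩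
      · exact ⟨h1.cons_cons x, by simp [h2]⟩
    · rintro ⟨h1, h2⟩
      cases b with
      | nil => simp at h2
      | cons y b =>
        by_cases hxy : y = x
        · subst hxy
          right
          exact ⟨b, ⟨List.cons_sublist_cons.1 h1, by simpa using h2⟩, rfl⟩
        · left
          have hy : y = !x := by cases x <;> cases y <;> simp_all
          subst hy
          have h3 := (List.sublist_cons_iff.1 h1).resolve_right (by simp)
          rw [h3.eq_of_length (by simpa using h2.symm)]

lemma nodup_ups (a : BW) : (ups a).Nodup := by
  induction a with
  | nil => simp [ups]
  | cons x a ih =>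
    simp only [ups, List.nodup_cons, List.mem_map, not_exists, not_and]
    refine ⟨fun b _ h => ?_, ih.map (List.cons_injective)⟩
    simp at h

lemma sum_upFinset (S : Set BW) (a : BW) (f : BW → ℝ) (hf : ∀ b, b ∉ S → f b = 0) :
    ∑ b ∈ upFinset S a, f b = ((ups a).map f).sum := by
  classical
  rw [← List.sum_toFinset f (nodup_ups a)]
  apply Finset.sum_subset
  · intro b hb
    simp only [upFinset, Set.Finite.mem_toFinset, Set.mem_ofPred_eq] at hb
    simpa [mem_ups] using hb.2
  · intro b hb hb'
    simp only [List.mem_toFinset, mem_ups] at hb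
    simp only [upFinset, Set.Finite.mem_toFinset, Set.mem_ofPred_eq, not_and] at hb'
    exact hf b fun h => hb' h hb

lemma zigF_nil (u : List (Bool × ℝ)) : zigF u [] = (u.map Prod.snd).sum := by
  induction u with
  | nil => simp [zigF]
  | cons p u ih => simp [zigF, headSum, ih, add_comm]

lemma sum_ups_headSum (ε : Bool) (x : ℝ) (u : List (Bool × ℝ))
    (hu : ∀ a, ((ups a).map (zigF u)).sum = (u.map Prod.snd).sum * zigF u a) (a : BW) :
    ((ups a).map (headSum ε x (zigF u))).sum =
      x * (headSum ε x (zigF u) a + zigF u a)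
        + (u.map Prod.snd).sum * headSum ε x (zigF u) a := by
  induction a with
  | nil =>
    cases ε <;> simp [ups, headSum, zigF_nil] <;> ring
  | cons y a ih =>
    have key : ((ups a).map (fun b => headSum ε x (zigF u) (y :: b))).sum
        = x * ((u.map Prod.snd).sum * zigF u a
          + if y = ε then ((ups a).map (headSum ε x (zigF u))).sum else 0) := by
      rw [← hu a]
      split_ifs with h
      · simp [headSum, h, List.sum_map_mul_left, List.sum_map_add]
      · simp [headSum, h, List.sum_map_mul_left]
    simp only [ups, List.map_cons, List.map_map, List.sum_cons, Function.comp_def]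
    rw [key, ih]
    by_cases h : y = ε
    · subst h
      simp [headSum]; ring
    · have h' : (!y) = ε := by cases y <;> cases ε <;> simp_all
      simp [headSum, h, h']; ring

lemma sum_ups_zigF (u : List (Bool × ℝ)) (a : BW) :
    ((ups a).map (zigF u)).sum = (u.map Prod.snd).sum * zigF u a := by
  induction u generalizing a with
  | nil => simp [zigF]
  | cons p u ih =>
    have := sum_ups_headSum p.1 p.2 u ih a
    have h2 : ((ups a).map (zigF (p :: u))).sum
        = ((ups a).map (zigF u)).sum + ((ups a).map (headSum p.1 p.2 (zigF u))).sum := by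
      rw [← List.sum_map_add]; rfl
    rw [h2, this, ih]
    simp only [zigF, List.map_cons, List.sum_cons]
    ring

/-- `F_λ(u)` with an explicit number of boxes, so as to include the empty zigzag. -/
noncomputable def boxF (u : List (Bool × ℝ)) (n : ℕ) (a : BW) : ℝ :=
  ∑ c ∈ (Finset.Nat.antidiagonalTuple u.length n).filter
      (fun c => ∀ i : Fin u.length,
        (a.drop (∑ i' ∈ Finset.univ.filter (· < i), c i')).take (c i - 1)
          = List.replicate (c i - 1) (u.get i).1),
    ∏ i, (u.get i).2 ^ c i

lemma sum_filter_lt_succ {M : Type*} [AddCommMonoid M] {k : ℕ} (c : Fin (k + 1) → M) (i : Fin k) :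
    ∑ i' ∈ Finset.univ.filter (· < i.succ), c i'
      = c 0 + ∑ i' ∈ Finset.univ.filter (· < i), c i'.succ := by
  simp [Finset.sum_filter, Fin.sum_univ_succ]

lemma sum_antidiagonalTuple_succ {M : Type*} [AddCommMonoid M] (k n : ℕ)
    (g : (Fin (k + 1) → ℕ) → M) :
    ∑ c ∈ Finset.Nat.antidiagonalTuple (k + 1) n, g c
      = ∑ ij ∈ Finset.HasAntidiagonal.antidiagonal n,
        ∑ c ∈ Finset.Nat.antidiagonalTuple k ij.2, g (Fin.cons ij.1 c) := by
  rw [Finset.sum_sigma']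
  refine Finset.sum_bij' (fun c _ => ⟨(c 0, ∑ i : Fin k, c i.succ), Fin.tail c⟩)
    (fun x _ => Fin.cons x.1.1 x.2) ?_ ?_ ?_ ?_ ?_
  · intro c hc
    simp only [Finset.Nat.mem_antidiagonalTuple, Fin.sum_univ_succ] at hc
    simp [Finset.Nat.mem_antidiagonalTuple, hc, Fin.tail]
  · rintro ⟨⟨i, j⟩, c⟩ hc
    simp only [Finset.mem_sigma, Finset.Nat.mem_antidiagonalTuple] at hc
    have hij : i + j = n := Finset.HasAntidiagonal.mem_antidiagonal.1 hc.1
    simp [Finset.Nat.mem_antidiagonalTuple, Fin.sum_univ_succ, hc, hij]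
  · intro c _
    simp
  · rintro ⟨⟨i, j⟩, c⟩ hc
    simp only [Finset.mem_sigma, Finset.Nat.mem_antidiagonalTuple] at hc
    simp [hc.2]
  · intro c _
    simp

lemma boxF_cons (p : Bool × ℝ) (u : List (Bool × ℝ)) (n : ℕ) (a : BW) :
    boxF (p :: u) n a = ∑ ij ∈ Finset.HasAntidiagonal.antidiagonal n,
      if a.take (ij.1 - 1) = List.replicate (ij.1 - 1) p.1
        then p.2 ^ ij.1 * boxF u ij.2 (a.drop ij.1) else 0 := by
  unfold boxF
  rw [Finset.sum_filter]
  simp only [List.length_cons]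
  rw [sum_antidiagonalTuple_succ]
  refine Finset.sum_congr rfl fun ij _ => ?_
  have hc : ∀ c : Fin u.length → ℕ, (∀ i : Fin (u.length + 1),
        (a.drop (∑ i' ∈ Finset.univ.filter (· < i),
          (Fin.cons ij.1 c : Fin (u.length + 1) → ℕ) i')).take
            ((Fin.cons ij.1 c : Fin (u.length + 1) → ℕ) i - 1)
          = List.replicate ((Fin.cons ij.1 c : Fin (u.length + 1) → ℕ) i - 1)
            ((p :: u).get i).1) ↔
      (a.take (ij.1 - 1) = List.replicate (ij.1 - 1) p.1 ∧ ∀ i : Fin u.length,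
          ((a.drop ij.1).drop (∑ i' ∈ Finset.univ.filter (· < i), c i')).take (c i - 1)
            = List.replicate (c i - 1) (u.get i).1) := by
    intro c
    rw [Fin.forall_fin_succ]
    refine and_congr (by simp) (forall_congr' fun i => ?_)
    rw [sum_filter_lt_succ]
    simp [List.drop_drop]
  split_ifs with h
  · rw [Finset.sum_filter, Finset.mul_sum]
    refine Finset.sum_congr rfl fun c _ => ?_
    simp only [hc c, h, true_and, Fin.prod_univ_succ]
    split_ifs <;> simp
  · refine Finset.sum_eq_zero fun c _ => ?_
    simp only [hc c, h, false_and, if_false]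

lemma boxF_zero (u : List (Bool × ℝ)) : boxF u 0 [] = 1 := by
  induction u with
  | nil => simp [boxF]
  | cons p u ih => simp [boxF_cons, ih]

lemma sum_boxF_eq_headSum (ε : Bool) (x : ℝ) (u : List (Bool × ℝ))
    (hu : ∀ a, boxF u (a.length + 1) a = zigF u a) (a : BW) :
    (∑ ij ∈ Finset.HasAntidiagonal.antidiagonal a.length,
      if a.take ij.1 = List.replicate ij.1 ε
        then x ^ (ij.1 + 1) * boxF u ij.2 (a.drop (ij.1 + 1)) else 0)
      = headSum ε x (zigF u) a := by
  induction a with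
  | nil => simp [headSum, boxF_zero]
  | cons y a ih =>
    rw [List.length_cons, Finset.Nat.sum_antidiagonal_succ]
    simp only [headSum, ← ih, ← hu, mul_add]
    congr 1
    · simp
    · split_ifs with h
      · subst h
        rw [Finset.mul_sum]
        refine Finset.sum_congr rfl fun ij _ => ?_
        simp only [List.take_succ_cons, List.replicate_succ, List.cons.injEq, true_and,
          List.drop_succ_cons]
        split_ifs
        · ring
        · simp
      · simp [List.replicate_succ, h]

lemma boxF_eq_zigF (u : List (Bool × ℝ)) (a : BW) : boxF u (a.length + 1) a = zigF u a := by
  induction u generalizing a with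
  | nil => simp [boxF, zigF]
  | cons p u ih =>
    rw [boxF_cons, Finset.Nat.sum_antidiagonal_succ]
    simp only [add_tsub_cancel_right, sum_boxF_eq_headSum p.1 p.2 u ih a]
    simp [zigF, ih]

lemma Fword_eq_zigF (u : List (Bool × ℝ)) (a : BW) : Fword u a = zigF u a :=
  boxF_eq_zigF u a

/-- The word with successive blocks of the given signs and multiplicities. -/
def blockWord : List Bool → (ℕ → ℕ) → BW
  | [], _ => []
  | s :: ss, m => List.replicate (m 0) s ++ blockWord ss (fun i => m (i + 1))

lemma blockWord_congr {ss : List Bool} {m M : ℕ → ℕ} (h : ∀ i < ss.length, m i = M i) :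
    blockWord ss m = blockWord ss M := by
  induction ss generalizing m M with
  | nil => rfl
  | cons s ss ih =>
    simp only [blockWord]
    rw [h 0 (by simp), ih fun i hi => h (i + 1) (by simpa using hi)]

lemma blockWord_sublist {ss : List Bool} {m M : ℕ → ℕ} (h : ∀ i < ss.length, m i ≤ M i) :
    (blockWord ss m).Sublist (blockWord ss M) := by
  induction ss generalizing m M with
  | nil => simp [blockWord]
  | cons s ss ih =>
    simp only [blockWord]
    exact (List.replicate_sublist_replicate s |>.2 (h 0 (by simp))).append
      (ih fun i hi => h (i + 1) (by simpa using hi))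

lemma length_blockWord (ss : List Bool) (m : ℕ → ℕ) :
    (blockWord ss m).length = ∑ i ∈ Finset.range ss.length, m i := by
  induction ss generalizing m with
  | nil => simp [blockWord]
  | cons s ss ih => simp [blockWord, ih, Finset.sum_range_succ', add_comm]

lemma exists_blockWord_of_sublist {ss : List Bool} {M : ℕ → ℕ} {l : BW}
    (h : l.Sublist (blockWord ss M)) : ∃ m, (∀ i, m i ≤ M i) ∧ l = blockWord ss m := by
  induction ss generalizing M l with
  | nil => exact ⟨M, fun _ => le_rfl, by simpa [blockWord] using h⟩
  | cons s ss ih =>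
    obtain ⟨l₁, l₂, rfl, h1, h2⟩ := List.sublist_append_iff.1 h
    obtain ⟨k, hk, rfl⟩ := List.sublist_replicate_iff.1 h1
    obtain ⟨m, hm, rfl⟩ := ih h2
    refine ⟨fun i => i.casesOn k m, fun i => ?_, rfl⟩
    cases i
    · exact hk
    · exact hm _

lemma alternating_sublist_blockWord {x ss : List Bool} {M : ℕ → ℕ} (hx : x.IsChain (· ≠ ·))
    (h : x.Sublist (blockWord ss M)) : x.length ≤ ss.length := by
  induction ss generalizing x M with
  | nil => simpa [blockWord] using h
  | cons s ss ih =>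
    obtain ⟨l₁, l₂, rfl, h1, h2⟩ := List.sublist_append_iff.1 h
    obtain ⟨k, hk, rfl⟩ := List.sublist_replicate_iff.1 h1
    have h3 := ih (List.isChain_append.1 hx).2.1 h2
    have h4 : k ≤ 1 := by
      by_contra! hk
      obtain ⟨k, rfl⟩ := Nat.exists_eq_add_of_le hk
      simp [add_comm, List.replicate_succ] at hx
    simp
    omega

lemma sublist_blockWord {ss : List Bool} {m : ℕ → ℕ} (hm : ∀ i < ss.length, 1 ≤ m i) :
    ss.Sublist (blockWord ss m) := by
  induction ss generalizing m with
  | nil => simp [blockWord]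
  | cons s ss ih =>
    have h0 := hm 0 (by simp)
    have h1 : [s].Sublist (List.replicate (m 0) s) := by
      rw [List.sublist_replicate_iff]
      exact ⟨1, h0, rfl⟩
    exact h1.append (ih fun i hi => hm (i + 1) (by simpa using hi))

lemma not_cons_blockWord_sublist {s : Bool} {ss ss' : List Bool} {m M : ℕ → ℕ}
    (hss : (s :: ss).IsChain (· ≠ ·)) (hm : ∀ i < ss.length, 1 ≤ m i)
    (hl : ss'.length ≤ ss.length) :
    ¬(s :: blockWord ss m).Sublist (blockWord ss' M) := by
  intro h
  have := alternating_sublist_blockWord hss (((sublist_blockWord hm).cons_cons s).trans h)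
  simp at this
  omega

lemma blockWord_rigid {ss : List Bool} {m M : ℕ → ℕ} (hss : ss.IsChain (· ≠ ·))
    (hm : ∀ i < ss.length, 1 ≤ m i) (h : (blockWord ss m).Sublist (blockWord ss M)) :
    ∀ i < ss.length, m i ≤ M i := by
  induction ss generalizing m M with
  | nil => simp
  | cons s ss ih =>
    have hm' : ∀ i < ss.length, 1 ≤ m (i + 1) := fun i hi => hm (i + 1) (by simpa using hi)
    obtain ⟨l₁, l₂, he, h1, h2⟩ := List.sublist_append_iff.1 h
    obtain ⟨k, hk, rfl⟩ := List.sublist_replicate_iff.1 h1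
    simp only [blockWord] at he
    have key : m 0 ≤ M 0 ∧ (blockWord ss fun i => m (i + 1)).Sublist
        (blockWord ss fun i => M (i + 1)) := by
      rcases le_or_gt (m 0) k with hle | hlt
      · refine ⟨hle.trans hk, ?_⟩
        obtain ⟨d, rfl⟩ := Nat.exists_eq_add_of_le hle
        rw [List.replicate_add, List.append_assoc, List.append_cancel_left_eq] at he
        rw [he]
        cases d with
        | zero => simpa using h2
        | succ d =>
          cases ss with
          | nil => simp [blockWord] at he
          | cons s' ss =>
            exfalso
            have h0 := hm' 0 (by simp)
            obtain ⟨e, he'⟩ := Nat.exists_eq_add_of_le h0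
            simp only [blockWord, zero_add] at he he'
            rw [he', add_comm 1 e, List.replicate_succ, List.replicate_succ] at he
            simp at he hss
            exact hss.1 he.1.symm
      · exfalso
        obtain ⟨d, hd⟩ := Nat.exists_eq_add_of_lt hlt
        rw [hd, add_assoc, List.replicate_add, List.append_assoc,
          List.append_cancel_left_eq] at he
        refine not_cons_blockWord_sublist hss hm' le_rfl (List.Sublist.trans ?_ h2)
        rw [← he, List.replicate_succ]
        exact (List.sublist_append_right _ _).cons_cons s
    intro i hi
    cases i with
    | zero => exact key.1
    | succ i => exact ih (List.isChain_of_isChain_cons hss) hm' key.2 i (by simpa using hi)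

lemma add_single_succ (m : ℕ → ℕ) (j : ℕ) :
    (fun i => (m + Pi.single (j + 1) 1 : ℕ → ℕ) (i + 1))
      = (fun i => m (i + 1)) + Pi.single j 1 := by
  funext i
  simp [Pi.single_apply]

lemma blockWord_add_single_eq_insert {ss : List Bool} {m : ℕ → ℕ} {s : Bool} {j : ℕ}
    (hj : j < ss.length) (h : s :: blockWord ss m = blockWord ss (m + Pi.single j 1)) :
    ss.getD j true = s ∧ ∀ q < j, 0 < m q → ss.getD q true = s := by
  induction ss generalizing m j with
  | nil => simp at hj
  | cons s' ss ih =>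
    cases j with
    | zero =>
      simp [blockWord, List.replicate_succ] at h
      simp [h]
    | succ j =>
      have hs := add_single_succ m j
      simp only [blockWord, hs] at h
      have h0 : (m + Pi.single (j + 1) 1 : ℕ → ℕ) 0 = m 0 := by simp
      rw [h0] at h
      have key : s :: blockWord ss (fun i => m (i + 1))
          = blockWord ss ((fun i => m (i + 1)) + Pi.single j 1) ∧ (0 < m 0 → s' = s) := by
        rcases Nat.eq_zero_or_pos (m 0) with hz | hp
        · rw [hz] at h
          exact ⟨by simpa only [List.replicate_zero, List.nil_append] using h, by simp [hz]⟩
        · obtain ⟨e, he⟩ := Nat.exists_eq_add_of_lt hp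
          have hss' : s = s' := by
            rw [he, List.replicate_succ] at h
            simp at h
            exact h.1
          subst hss'
          refine ⟨?_, fun _ => rfl⟩
          rw [← List.cons_append, ← List.replicate_succ, List.replicate_succ', List.append_assoc,
            List.append_cancel_left_eq] at h
          exact h
      obtain ⟨h1, h2⟩ := ih (by simpa using hj) key.1
      refine ⟨by simpa using h1, fun q hq hpos => ?_⟩
      cases q with
      | zero => simpa using key.2 hpos
      | succ q => simpa using h2 q (by omega) hpos

lemma blockWord_add_single_inj {ss : List Bool} {m : ℕ → ℕ} {i j : ℕ} (hij : i < j)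
    (hj : j < ss.length)
    (h : blockWord ss (m + Pi.single i 1) = blockWord ss (m + Pi.single j 1)) :
    ss.getD j true = ss.getD i true ∧
      ∀ q, i < q → q < j → 0 < m q → ss.getD q true = ss.getD i true := by
  induction ss generalizing m i j with
  | nil => simp at hj
  | cons s ss ih =>
    obtain ⟨j, rfl⟩ : ∃ j', j = j' + 1 := ⟨j - 1, by omega⟩
    have hs := add_single_succ m
    have hj' : j < ss.length := by simpa using hj
    cases i with
    | zero =>
      have h1 : s :: blockWord ss (fun i => m (i + 1))
          = blockWord ss ((fun i => m (i + 1)) + Pi.single j 1) := by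
        simp only [blockWord, hs] at h
        have e1 : (m + Pi.single (j + 1) 1 : ℕ → ℕ) 0 = m 0 := by simp
        have e2 : (m + Pi.single 0 1 : ℕ → ℕ) 0 = m 0 + 1 := by simp
        rw [e1, e2, List.replicate_succ', List.append_assoc, List.append_cancel_left_eq] at h
        rw [← h]
        simp only [List.singleton_append, List.cons.injEq, true_and]
        exact blockWord_congr fun i _ => by simp
      obtain ⟨h2, h3⟩ := blockWord_add_single_eq_insert hj' h1
      refine ⟨by simpa using h2, fun q hq hqj hpos => ?_⟩
      obtain ⟨q, rfl⟩ : ∃ q', q = q' + 1 := ⟨q - 1, by omega⟩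
      simpa using h3 q (by omega) hpos
    | succ i =>
      simp only [blockWord, hs] at h
      have e1 : ∀ j, (m + Pi.single (j + 1) 1 : ℕ → ℕ) 0 = m 0 := by simp
      rw [e1, e1, List.append_cancel_left_eq] at h
      obtain ⟨h2, h3⟩ := ih (by omega) hj' h
      refine ⟨by simpa using h2, fun q hq hqj hpos => ?_⟩
      obtain ⟨q, rfl⟩ : ∃ q', q = q' + 1 := ⟨q - 1, by omega⟩
      simpa using h3 q (by omega) (by omega) hpos

/-- The multiplicities of the clusters of `cs`, the infinite ones being replaced by the values
of `n`. -/
def mults (cs : List (Bool × ℕ∞)) (n : ℕ → ℕ) (i : ℕ) : ℕ :=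
  if (cs.getD i (true, 1)).2 = ⊤ then n i else (cs.getD i (true, 1)).2.toNat

/-- The instance of `cs` in which the infinite cluster in position `i` gets multiplicity
`n i`. -/
def inst (cs : List (Bool × ℕ∞)) (n : ℕ → ℕ) : BW :=
  blockWord (cs.map Prod.fst) (mults cs n)

lemma inst_cons (c : Bool × ℕ∞) (cs : List (Bool × ℕ∞)) (n : ℕ → ℕ) :
    inst (c :: cs) n =
      List.replicate (if c.2 = ⊤ then n 0 else c.2.toNat) c.1 ++ inst cs (fun i => n (i + 1)) :=
  rfl

lemma inst_nil (n : ℕ → ℕ) : inst [] n = [] := rfl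

lemma clWord_eq_inst (cs : List (Bool × ℕ∞)) (N : ℕ) : clWord cs N = inst cs fun _ => N := by
  induction cs with
  | nil => rfl
  | cons c cs ih => rw [inst_cons, ← ih]; simp [clWord]

lemma inst_append (cs cs' : List (Bool × ℕ∞)) (n : ℕ → ℕ) :
    inst (cs ++ cs') n = inst cs n ++ inst cs' (fun i => n (i + cs.length)) := by
  induction cs generalizing n with
  | nil => simp [inst_nil]
  | cons c cs ih => simp [inst_cons, ih, add_assoc]

lemma inst_congr {cs : List (Bool × ℕ∞)} {n n' : ℕ → ℕ}
    (h : ∀ i < cs.length, (cs.getD i (true, 1)).2 = ⊤ → n i = n' i) : inst cs n = inst cs n' := by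
  refine blockWord_congr fun i hi => ?_
  unfold mults
  split_ifs with hc
  · exact h i (by simpa using hi) hc
  · rfl

lemma mults_mono {cs : List (Bool × ℕ∞)} {n n' : ℕ → ℕ} (h : ∀ i, n i ≤ n' i) (i : ℕ) :
    mults cs n i ≤ mults cs n' i := by
  unfold mults
  split_ifs
  · exact h i
  · rfl

lemma inst_sublist {cs : List (Bool × ℕ∞)} {n n' : ℕ → ℕ} (h : ∀ i, n i ≤ n' i) :
    (inst cs n).Sublist (inst cs n') :=
  blockWord_sublist fun i _ => mults_mono h i

lemma mults_add_single {cs : List (Bool × ℕ∞)} {n : ℕ → ℕ} {j : ℕ}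
    (hj : (cs.getD j (true, 1)).2 = ⊤) :
    mults cs (n + Pi.single j 1) = mults cs n + Pi.single j 1 := by
  funext i
  by_cases hij : i = j
  · subst hij
    simp [mults, -List.getD_eq_getElem?_getD, hj]
  · simp [mults, hij]

lemma length_inst (cs : List (Bool × ℕ∞)) (n : ℕ → ℕ) :
    (inst cs n).length = ∑ i ∈ Finset.range cs.length, mults cs n i := by
  simp [inst, length_blockWord]

lemma getD_two_ne_top {cs : List (Bool × ℕ∞)} {p : ℕ} (h : (cs.getD p (true, 1)).2 = ⊤) :
    p < cs.length := by
  by_contra hp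
  rw [List.getD_eq_default _ _ (by omega)] at h
  simp at h

lemma mem_Zcl_inst (cs : List (Bool × ℕ∞)) (n : ℕ → ℕ) : inst cs n ∈ Zcl cs := by
  refine ⟨∑ i ∈ Finset.range cs.length, n i, ?_⟩
  rw [clWord_eq_inst]
  refine blockWord_sublist fun i hi => ?_
  unfold mults
  split_ifs
  · exact Finset.single_le_sum (f := n) (fun _ _ => Nat.zero_le _) (by simpa using hi)
  · rfl

lemma clWord_mono (cs : List (Bool × ℕ∞)) {N M : ℕ} (h : N ≤ M) :
    (clWord cs N).Sublist (clWord cs M) := by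
  rw [clWord_eq_inst, clWord_eq_inst]
  exact inst_sublist fun _ => h

lemma mem_Zcl_of_sublist {cs : List (Bool × ℕ∞)} {a b : BW} (h : a.Sublist b) (hb : b ∈ Zcl cs) :
    a ∈ Zcl cs := by
  obtain ⟨N, hN⟩ := hb
  exact ⟨N, h.trans hN⟩

lemma map_fst_decAt (cs : List (Bool × ℕ∞)) (p : ℕ) :
    (decAt cs p).map Prod.fst = cs.map Prod.fst := by
  induction cs generalizing p with
  | nil => simp [decAt]
  | cons c cs ih =>
    cases p with
    | zero => simp [decAt]
    | succ p => simpa [decAt] using ih p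

lemma mults_decAt {cs : List (Bool × ℕ∞)} {p : ℕ} (hp : p < cs.length)
    (hfin : (cs.getD p (true, 1)).2 ≠ ⊤) (n : ℕ → ℕ) :
    mults (decAt cs p) n
      = Function.update (mults cs n) p (mults cs n p - 1) := by
  funext i
  by_cases hip : i = p
  · subst hip
    have h1 : (decAt cs i).getD i (true, 1)
        = ((cs.getD i (true, 1)).1, (cs.getD i (true, 1)).2 - 1) := by
      simp [decAt, hp]
    have h2 : (cs.getD i (true, 1)).2 - 1 ≠ ⊤ := by
      lift (cs.getD i (true, 1)).2 to ℕ using hfin with k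
      exact_mod_cast ENat.natCast_ne_top (k - 1)
    rw [Function.update_self]
    unfold mults
    rw [h1, if_neg h2, if_neg hfin]
    exact ENat.toNat_sub (by simp) _
  · rw [Function.update_of_ne hip]
    have h1 : (decAt cs p).getD i (true, 1) = cs.getD i (true, 1) := by
      simp [decAt, Ne.symm hip]
    unfold mults
    rw [h1]

lemma inst_decAt {cs : List (Bool × ℕ∞)} {p : ℕ} (hp : p < cs.length)
    (hfin : (cs.getD p (true, 1)).2 ≠ ⊤) (n : ℕ → ℕ) :
    inst (decAt cs p) n = blockWord (cs.map Prod.fst)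
      (Function.update (mults cs n) p (mults cs n p - 1)) := by
  rw [inst, map_fst_decAt, mults_decAt hp hfin]

/-- The positions of the infinite clusters. -/
def infPos (cs : List (Bool × ℕ∞)) : Finset ℕ :=
  (Finset.range cs.length).filter fun j => (cs.getD j (true, 1)).2 = ⊤

lemma mem_infPos {cs : List (Bool × ℕ∞)} {j : ℕ} :
    j ∈ infPos cs ↔ (cs.getD j (true, 1)).2 = ⊤ := by
  simp only [infPos, Finset.mem_filter, Finset.mem_range, and_iff_right_iff_imp]
  exact getD_two_ne_top

lemma isChain_map_fst {cs : List (Bool × ℕ∞)} (h : cs.IsChain fun c d => c.1 ≠ d.1) :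
    (cs.map Prod.fst).IsChain (· ≠ ·) := by
  rw [List.isChain_map]
  exact h

lemma one_le_mults {cs : List (Bool × ℕ∞)} (hpos : ∀ c ∈ cs, c.2 ≠ 0) {n : ℕ → ℕ}
    (hn : ∀ i, 1 ≤ n i) {i : ℕ} (hi : i < cs.length) : 1 ≤ mults cs n i := by
  unfold mults
  split_ifs with h
  · exact hn i
  · have h0 : (cs.getD i (true, 1)).2 ≠ 0 := by
      refine hpos _ ?_
      rw [List.getD_eq_getElem _ _ hi]
      exact List.getElem_mem hi
    exact Nat.one_le_iff_ne_zero.2 fun h1 => (ENat.toNat_eq_zero.1 h1).elim h0 h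

lemma inst_notMem_decAt {cs : List (Bool × ℕ∞)} (hch : cs.IsChain fun c d => c.1 ≠ d.1)
    (hpos : ∀ c ∈ cs, c.2 ≠ 0) {n : ℕ → ℕ} (hn : ∀ i, 1 ≤ n i) {p : ℕ} (hp : p < cs.length)
    (hfin : (cs.getD p (true, 1)).2 ≠ ⊤) : inst cs n ∉ Zcl (decAt cs p) := by
  rintro ⟨N, hN⟩
  rw [clWord_eq_inst, inst_decAt hp hfin] at hN
  have h1 := blockWord_rigid (isChain_map_fst hch)
    (fun i hi => one_le_mults hpos hn (by simpa using hi)) hN p (by simpa using hp)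
  have h2 := one_le_mults hpos hn hp
  have h3 : mults cs n p = mults cs (fun _ => N) p := by simp only [mults, if_neg hfin]
  rw [Function.update_self] at h1
  omega

lemma inst_add_single (cs : List (Bool × ℕ∞)) (n : ℕ → ℕ) {j : ℕ} (hj : j ∈ infPos cs) :
    inst cs (n + Pi.single j 1)
      = blockWord (cs.map Prod.fst) (mults cs n + Pi.single j 1) := by
  rw [inst, mults_add_single (mem_infPos.1 hj)]

lemma coveredBy_inst_add_single (cs : List (Bool × ℕ∞)) (n : ℕ → ℕ) {j : ℕ}
    (hj : j ∈ infPos cs) : CoveredBy (inst cs n) (inst cs (n + Pi.single j 1)) := by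
  refine ⟨inst_sublist fun i => Nat.le_add_right _ _, ?_⟩
  rw [inst_add_single cs n hj, inst, length_blockWord, length_blockWord]
  have : j ∈ Finset.range (cs.map Prod.fst).length := by
    have := getD_two_ne_top (mem_infPos.1 hj)
    simpa using this
  simp [Finset.sum_add_distrib, Finset.sum_pi_single', getD_two_ne_top (mem_infPos.1 hj)]

lemma exists_eq_add_single_of_coveredBy {cs : List (Bool × ℕ∞)}
    (hch : cs.IsChain fun c d => c.1 ≠ d.1)
    (hpos : ∀ c ∈ cs, c.2 ≠ 0) {n : ℕ → ℕ} (hn : ∀ i, 1 ≤ n i) {b : BW}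
    (hb : b ∈ Zcl cs) (hab : CoveredBy (inst cs n) b) :
    ∃ j ∈ infPos cs, b = inst cs (n + Pi.single j 1) := by
  obtain ⟨N, hN⟩ := hb
  rw [clWord_eq_inst] at hN
  obtain ⟨m, hm, rfl⟩ := exists_blockWord_of_sublist hN
  have h1 := blockWord_rigid (isChain_map_fst hch)
    (fun i hi => one_le_mults hpos hn (by simpa using hi)) hab.1
  have h2 := hab.2
  rw [inst, length_blockWord, length_blockWord] at h2
  obtain ⟨j, hj, hlt⟩ : ∃ j ∈ Finset.range (cs.map Prod.fst).length, mults cs n j < m j := by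
    apply Finset.exists_lt_of_sum_lt
    omega
  have hjtop : j ∈ infPos cs := by
    rw [mem_infPos]
    by_contra hfin
    have h3 : mults cs n j = mults cs (fun _ => N) j := by simp only [mults, if_neg hfin]
    have := hm j
    omega
  refine ⟨j, hjtop, ?_⟩
  rw [inst_add_single cs n hjtop]
  have hle : ∀ i ∈ Finset.range (cs.map Prod.fst).length,
      (mults cs n + Pi.single j 1 : ℕ → ℕ) i ≤ m i := by
    intro i hi
    by_cases hij : i = j
    · subst hij
      simpa using hlt
    · simpa [hij] using h1 i (Finset.mem_range.1 hi)
  have hsum : ∑ i ∈ Finset.range (cs.map Prod.fst).length,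
      (mults cs n + Pi.single j 1 : ℕ → ℕ) i
        = ∑ i ∈ Finset.range (cs.map Prod.fst).length, m i := by
    rw [h2]
    simp only [Pi.add_apply, Finset.sum_add_distrib, Finset.sum_pi_single', if_pos hj]
  have heq := (Finset.sum_eq_sum_iff_of_le hle).1 hsum
  exact blockWord_congr fun i hi => (heq i (Finset.mem_range.2 hi)).symm

lemma inst_add_single_injOn {cs : List (Bool × ℕ∞)} (hch : cs.IsChain fun c d => c.1 ≠ d.1)
    (hpos : ∀ c ∈ cs, c.2 ≠ 0) {n : ℕ → ℕ} (hn : ∀ i, 1 ≤ n i) :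
    Set.InjOn (fun j => inst cs (n + Pi.single j 1)) (infPos cs) := by
  intro i hi j hj hij
  simp only at hij
  by_contra hne
  have h1 := blockWord_rigid (isChain_map_fst hch) (M := mults cs n + Pi.single j 1)
    (m := mults cs n + Pi.single i 1)
    (fun q hq => (one_le_mults hpos hn (by simpa using hq)).trans (Nat.le_add_right _ _))
    (by rw [← inst_add_single cs n hi, ← inst_add_single cs n hj, hij]) i
    (by simpa using getD_two_ne_top (mem_infPos.1 hi))
  simp [hne] at h1

lemma upFinset_inst {cs : List (Bool × ℕ∞)} (hch : cs.IsChain fun c d => c.1 ≠ d.1)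
    (hpos : ∀ c ∈ cs, c.2 ≠ 0) {n : ℕ → ℕ} (hn : ∀ i, 1 ≤ n i) :
    upFinset (Zcl cs) (inst cs n)
      = (infPos cs).image fun j => inst cs (n + Pi.single j 1) := by
  ext b
  simp only [upFinset, Set.Finite.mem_toFinset, Set.mem_ofPred_eq, Finset.mem_image]
  constructor
  · rintro ⟨h1, h2⟩
    obtain ⟨j, hj, rfl⟩ := exists_eq_add_single_of_coveredBy hch hpos hn h1 h2
    exact ⟨j, hj, rfl⟩
  · rintro ⟨j, hj, rfl⟩
    exact ⟨mem_Zcl_inst _ _, coveredBy_inst_add_single cs n hj⟩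

/-- The generic words of `cs`: the instances in which all infinite clusters are present at
least twice. -/
def Generic (cs : List (Bool × ℕ∞)) : Set BW := {a | ∃ n, (∀ i, 2 ≤ n i) ∧ a = inst cs n}

lemma generic_append {cs cs' : List (Bool × ℕ∞)} {a b : BW} (ha : a ∈ Generic cs)
    (hb : b ∈ Generic cs') : a ++ b ∈ Generic (cs ++ cs') := by
  obtain ⟨n, hn, rfl⟩ := ha
  obtain ⟨n', hn', rfl⟩ := hb
  refine ⟨fun i => if i < cs.length then n i else n' (i - cs.length), fun i => ?_, ?_⟩
  · dsimp only
    split_ifs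
    · exact hn _
    · exact hn' _
  · rw [inst_append]
    congr 1
    · exact inst_congr fun i hi _ => by simp [hi]
    · exact inst_congr fun i hi _ => by simp

lemma generic_cons_self {ε : Bool} {cs : List (Bool × ℕ∞)} {b : BW}
    (hb : b ∈ Generic ((ε, ⊤) :: cs)) : ε :: b ∈ Generic ((ε, ⊤) :: cs) := by
  obtain ⟨n, hn, rfl⟩ := hb
  refine ⟨n + Pi.single 0 1, fun i => (hn i).trans (Nat.le_add_right _ _), ?_⟩
  simp [inst_cons, List.replicate_succ]

lemma generic_cons_inf {ε : Bool} {cs : List (Bool × ℕ∞)} {b : BW} (hb : b ∈ Generic cs) :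
    ε :: ε :: b ∈ Generic ((ε, ⊤) :: cs) :=
  generic_append (cs := [(ε, ⊤)]) (a := [ε, ε])
    ⟨fun _ => 2, fun _ => le_rfl, by simp [inst_cons, inst_nil, List.replicate_succ]⟩ hb

lemma generic_cons_one {s : Bool} {cs : List (Bool × ℕ∞)} {b : BW} (hb : b ∈ Generic cs) :
    s :: b ∈ Generic ((s, 1) :: cs) :=
  generic_append (cs := [(s, 1)]) (a := [s])
    ⟨fun _ => 2, fun _ => le_rfl, by simp [inst_cons, inst_nil]⟩ hb

lemma nil_mem_Zcl (cs : List (Bool × ℕ∞)) : [] ∈ Zcl cs := ⟨0, by simp⟩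

lemma clWord_cons (c : Bool × ℕ∞) (cs : List (Bool × ℕ∞)) (N : ℕ) :
    clWord (c :: cs) N = List.replicate (if c.2 = ⊤ then N else c.2.toNat) c.1 ++ clWord cs N := by
  simp [clWord]

lemma Zcl_subset_cons (c : Bool × ℕ∞) (cs : List (Bool × ℕ∞)) : Zcl cs ⊆ Zcl (c :: cs) := by
  rintro a ⟨N, h⟩
  exact ⟨N, by rw [clWord_cons]; exact h.trans (List.sublist_append_right _ _)⟩

lemma cons_mem_Zcl_inf {ε : Bool} {cs : List (Bool × ℕ∞)} {a : BW} :
    ε :: a ∈ Zcl ((ε, ⊤) :: cs) ↔ a ∈ Zcl ((ε, ⊤) :: cs) := by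
  refine ⟨mem_Zcl_of_sublist (List.sublist_cons_self _ _), ?_⟩
  rintro ⟨N, h⟩
  refine ⟨N + 1, ?_⟩
  rw [clWord_cons] at h ⊢
  simp only [if_true, List.replicate_succ, List.cons_append] at h ⊢
  exact (h.trans ((List.Sublist.refl _).append (clWord_mono cs (Nat.le_succ N)))).cons_cons ε

lemma cons_sublist_replicate_append {s ε : Bool} (hs : s ≠ ε) {a l : BW} {k : ℕ} :
    (s :: a).Sublist (List.replicate k ε ++ l) ↔ (s :: a).Sublist l := by
  refine ⟨fun h => ?_, fun h => h.trans (List.sublist_append_right _ _)⟩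
  induction k with
  | zero => simpa using h
  | succ k ih =>
    rw [List.replicate_succ, List.cons_append] at h
    exact ih ((List.sublist_cons_iff.1 h).resolve_right (by simp [hs]))

lemma cons_not_mem_Zcl_inf {ε : Bool} {cs : List (Bool × ℕ∞)} {a : BW} :
    (!ε) :: a ∈ Zcl ((ε, ⊤) :: cs) ↔ (!ε) :: a ∈ Zcl cs := by
  refine ⟨?_, fun h => Zcl_subset_cons _ _ h⟩
  rintro ⟨N, h⟩
  rw [clWord_cons, cons_sublist_replicate_append (by simp)] at h
  exact ⟨N, h⟩

lemma cons_mem_Zcl_one {s : Bool} {cs : List (Bool × ℕ∞)} {a : BW} :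
    s :: a ∈ Zcl ((s, 1) :: cs) ↔ a ∈ Zcl cs := by
  simp [Zcl, clWord_cons]

/-- Lists of clusters forming a finite template, together with positive weights attached to
their infinite clusters. -/
inductive WeightedFinite : List (Bool × ℕ∞) → List (Bool × ℝ) → Prop
  | single (ε : Bool) (x : ℝ) : 0 < x → WeightedFinite [(ε, ⊤)] [(ε, x)]
  | inf (ε : Bool) (x : ℝ) (cs u) : 0 < x → WeightedFinite ((!ε, ⊤) :: cs) u →
      WeightedFinite ((ε, ⊤) :: (!ε, ⊤) :: cs) ((ε, x) :: u)
  | sep (ε : Bool) (x : ℝ) (cs u) : 0 < x → WeightedFinite ((ε, ⊤) :: cs) u →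
      WeightedFinite ((ε, ⊤) :: (!ε, 1) :: (ε, ⊤) :: cs) ((ε, x) :: u)

lemma headSum_pos_iff {ε : Bool} {x : ℝ} (hx : 0 < x) {f : BW → ℝ} {R Z : Set BW}
    (hf : ∀ a, 0 ≤ f a) (hfR : ∀ a, 0 < f a ↔ a ∈ R) (hnil : [] ∈ Z)
    (hself : ∀ a, ε :: a ∈ Z ↔ a ∈ Z) (hRZ : R ⊆ Z) (hother : ∀ a, (!ε) :: a ∈ Z ↔ a ∈ R)
    (a : BW) : 0 ≤ headSum ε x f a ∧ (0 < headSum ε x f a ↔ a ∈ Z) := by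
  induction a with
  | nil => simp [headSum, hx, hx.le, hnil]
  | cons y a ih =>
    by_cases hy : y = ε
    · subst hy
      simp only [headSum, if_true, hself, mul_pos_iff_of_pos_left hx]
      refine ⟨mul_nonneg hx.le (add_nonneg (hf a) ih.1), fun h => ?_, fun h => ?_⟩
      · by_contra ha
        have h1 : ¬ 0 < headSum y x f a := fun h => ha (ih.2.1 h)
        have h2 : ¬ 0 < f a := fun h => ha (hRZ ((hfR a).1 h))
        linarith
      · exact add_pos_of_nonneg_of_pos (hf a) (ih.2.2 h)
    · have hy' : y = !ε := by cases y <;> cases ε <;> simp_all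
      subst hy'
      simp only [headSum, hy, if_false, add_zero, hother, mul_pos_iff_of_pos_left hx, hfR]
      exact ⟨mul_nonneg hx.le (hf a), trivial⟩

lemma WeightedFinite.zigF_pos_iff {cs : List (Bool × ℕ∞)} {u : List (Bool × ℝ)}
    (h : WeightedFinite cs u) (a : BW) : 0 ≤ zigF u a ∧ (0 < zigF u a ↔ a ∈ Zcl cs) := by
  have step : ∀ (ε : Bool) (x : ℝ) (u : List (Bool × ℝ)) (R Z : Set BW) (_ : 0 < x)
      (_ : ∀ a, 0 ≤ zigF u a ∧ (0 < zigF u a ↔ a ∈ R)) (_ : [] ∈ Z)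
      (_ : ∀ a, ε :: a ∈ Z ↔ a ∈ Z) (_ : R ⊆ Z) (_ : ∀ a, (!ε) :: a ∈ Z ↔ a ∈ R) (a : BW),
      0 ≤ zigF ((ε, x) :: u) a ∧ (0 < zigF ((ε, x) :: u) a ↔ a ∈ Z) := by
    intro ε x u R Z hx hu hnil hself hRZ hother a
    have h1 := headSum_pos_iff hx (fun a => (hu a).1) (fun a => (hu a).2) hnil hself hRZ hother a
    refine ⟨add_nonneg (hu a).1 h1.1, fun h => ?_, fun h =>
      add_pos_of_nonneg_of_pos (hu a).1 (h1.2.2 h)⟩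
    by_contra ha
    have h2 : ¬ 0 < headSum ε x (zigF u) a := fun h => ha (h1.2.1 h)
    have h3 : ¬ 0 < zigF u a := fun h => ha (hRZ ((hu a).2.1 h))
    simp only [zigF] at h
    linarith
  induction h generalizing a with
  | single ε x hx =>
    refine step ε x [] ∅ _ hx (by simp [zigF]) (nil_mem_Zcl _) (fun a => cons_mem_Zcl_inf)
      (by simp) (fun a => ?_) a
    rw [cons_not_mem_Zcl_inf]
    simp [Zcl, clWord]
  | inf ε x cs u hx _ ih =>
    refine step ε x u _ _ hx ih (nil_mem_Zcl _) (fun a => cons_mem_Zcl_inf)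
      (Zcl_subset_cons _ _) (fun a => ?_) a
    rw [cons_not_mem_Zcl_inf, cons_mem_Zcl_inf]
  | sep ε x cs u hx _ ih =>
    refine step ε x u _ _ hx ih (nil_mem_Zcl _) (fun a => cons_mem_Zcl_inf)
      ((Zcl_subset_cons _ _).trans (Zcl_subset_cons _ _)) (fun a => ?_) a
    rw [cons_not_mem_Zcl_inf, cons_mem_Zcl_one]

lemma WeightedFinite.zigF_nonneg {cs : List (Bool × ℕ∞)} {u : List (Bool × ℝ)}
    (h : WeightedFinite cs u) (a : BW) : 0 ≤ zigF u a := (h.zigF_pos_iff a).1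

lemma WeightedFinite.zigF_eq_zero {cs : List (Bool × ℕ∞)} {u : List (Bool × ℝ)}
    (h : WeightedFinite cs u) {a : BW} (ha : a ∉ Zcl cs) : zigF u a = 0 :=
  le_antisymm (not_lt.1 fun h1 => ha ((h.zigF_pos_iff a).2.1 h1)) (h.zigF_nonneg a)

lemma WeightedFinite.sum_upFinset_zigF {cs : List (Bool × ℕ∞)} {u : List (Bool × ℝ)}
    (h : WeightedFinite cs u) (a : BW) :
    ∑ b ∈ upFinset (Zcl cs) a, zigF u b = (u.map Prod.snd).sum * zigF u a := by
  rw [sum_upFinset _ _ _ fun b hb => h.zigF_eq_zero hb, sum_ups_zigF]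

lemma cons_inst_notMem {s : Bool} {cs : List (Bool × ℕ∞)} {n : ℕ → ℕ}
    (hch : (s :: cs.map Prod.fst).IsChain (· ≠ ·)) (hpos : ∀ c ∈ cs, c.2 ≠ 0)
    (hn : ∀ i, 1 ≤ n i) : s :: inst cs n ∉ Zcl cs := by
  rintro ⟨N, hN⟩
  rw [clWord_eq_inst] at hN
  exact not_cons_blockWord_sublist hch (fun i hi => one_le_mults hpos hn (by simpa using hi))
    le_rfl hN

lemma WeightedFinite.isChain {cs : List (Bool × ℕ∞)} {u : List (Bool × ℝ)}
    (h : WeightedFinite cs u) : (cs.map Prod.fst).IsChain (· ≠ ·) := by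
  induction h with
  | single ε x hx => simp
  | inf ε x cs u hx _ ih => simpa using ih
  | sep ε x cs u hx _ ih => simpa using ih

lemma WeightedFinite.ne_zero {cs : List (Bool × ℕ∞)} {u : List (Bool × ℝ)}
    (h : WeightedFinite cs u) : ∀ c ∈ cs, c.2 ≠ 0 := by
  induction h with
  | single ε x hx => simp
  | inf ε x cs u hx _ ih => simpa using ih
  | sep ε x cs u hx _ ih => simpa using ih

lemma WeightedFinite.of_isFinite {cs : List (Bool × ℕ∞)} {u : List (Bool × ℝ)}
    (hch : (cs.map Prod.fst).IsChain (· ≠ ·)) (hne : cs ≠ [])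
    (hfin : ∀ i < cs.length, (cs.getD i (true, 1)).2 ≠ ⊤ →
      0 < i ∧ i + 1 < cs.length ∧ (cs.getD i (true, 1)).2 = 1 ∧
        (cs.getD (i - 1) (true, 1)).2 = ⊤ ∧ (cs.getD (i + 1) (true, 1)).2 = ⊤)
    (hu : u.map Prod.fst = infSigns cs) (hpos : ∀ p ∈ u, 0 < p.2) : WeightedFinite cs u := by
  induction hN : cs.length using Nat.strong_induction_on generalizing cs u with
  | _ N IH =>
  subst hN
  rcases cs with _ | ⟨⟨ε, m⟩, _ | ⟨⟨δ, m'⟩, cs⟩⟩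
  · exact absurd rfl hne
  · have hm : m = ⊤ := by
      by_contra hm
      have := hfin 0 (by simp) (by simpa using hm)
      omega
    subst hm
    obtain ⟨p, rfl⟩ : ∃ p, u = [p] := by
      rw [← List.length_eq_one_iff, ← List.length_map (f := Prod.fst), hu]
      rfl
    obtain ⟨ε', x⟩ := p
    simp [infSigns] at hu
    subst hu
    exact .single _ _ (hpos _ List.mem_cons_self)
  · have hm : m = ⊤ := by
      by_contra hm
      have := hfin 0 (by simp) (by simpa using hm)
      omega
    subst hm
    have hδ : δ = !ε := by
      have := (List.isChain_cons_cons.1 hch).1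
      revert this
      cases ε <;> cases δ <;> simp
    subst hδ
    cases u with
    | nil => simp [infSigns] at hu
    | cons p u =>
    obtain ⟨ε', x⟩ := p
    have hu2 : ε' = ε := by
      simp [infSigns] at hu
      exact hu.1
    subst hu2
    by_cases hm' : m' = ⊤
    · subst hm'
      refine .inf _ _ _ _ (hpos _ List.mem_cons_self) (IH _ (by simp)
        (List.isChain_of_isChain_cons hch) (by simp) (fun i hi h => ?_) ?_
        (fun p hp => hpos p (by simp [hp])) rfl)
      · have h1 := hfin (i + 1) (by simpa using hi) (by simpa using h)
        have h0 : i ≠ 0 := by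
          rintro rfl
          simp at h
        obtain ⟨i, rfl⟩ := Nat.exists_eq_succ_of_ne_zero h0
        simpa using h1
      · simpa [infSigns] using hu
    · have h1 := hfin 1 (by simp) (by simpa using hm')
      rcases cs with _ | ⟨⟨η, m''⟩, cs⟩
      · simp at h1
      · obtain ⟨rfl, rfl⟩ : m' = 1 ∧ m'' = ⊤ := by simpa using h1
        have hη : η = ε' := by
          have := (List.isChain_cons_cons.1 (List.isChain_of_isChain_cons hch)).1
          revert this
          cases ε' <;> cases η <;> simp
        subst hη
        refine .sep _ _ _ _ (hpos _ List.mem_cons_self) (IH _ (by simp)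
          (List.isChain_of_isChain_cons (List.isChain_of_isChain_cons hch))
          (by simp) (fun i hi h => ?_) ?_ (fun p hp => hpos p (by simp [hp])) rfl)
        · have h1 := hfin (i + 2) (by simpa using hi) (by simpa using h)
          have h0 : i ≠ 0 := by
            rintro rfl
            simp at h
          obtain ⟨i, rfl⟩ := Nat.exists_eq_succ_of_ne_zero h0
          simp only [List.length_cons, Nat.succ_eq_add_one, add_assoc, Nat.reduceAdd] at h1 ⊢
          exact ⟨by omega, by omega, by simpa using h1.2.2⟩
        · simpa [infSigns] using hu

lemma headSum_replicate_append {ε : Bool} {x : ℝ} {f : BW → ℝ} {a : BW}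
    (hf : ∀ i, f (List.replicate (i + 1) ε ++ a) = 0) (k : ℕ) :
    headSum ε x f (List.replicate (k + 1) ε ++ a) = x ^ (k + 1) * (f a + headSum ε x f a) := by
  induction k with
  | zero => simp [headSum]
  | succ k ih =>
    rw [List.replicate_succ, List.cons_append]
    simp only [headSum, hf, if_true, ih]
    ring

lemma zigF_cons_inst {ε : Bool} {x : ℝ} {u : List (Bool × ℝ)} {cs : List (Bool × ℕ∞)}
    {n : ℕ → ℕ} (hn : 1 ≤ n 0)
    (hf : ∀ i, zigF u (List.replicate (i + 1) ε ++ inst cs fun i => n (i + 1)) = 0) :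
    zigF ((ε, x) :: u) (inst ((ε, ⊤) :: cs) n) =
      x ^ n 0 * (zigF u (inst cs fun i => n (i + 1))
        + headSum ε x (zigF u) (inst cs fun i => n (i + 1))) := by
  obtain ⟨k, hk⟩ := Nat.exists_eq_add_of_le' hn
  rw [inst_cons]
  simp only [if_true, zigF, hk, headSum_replicate_append hf, hf, zero_add]

lemma WeightedFinite.zigF_replicate_inst {ε : Bool} {cs : List (Bool × ℕ∞)}
    {u : List (Bool × ℝ)} (h : WeightedFinite cs u) (hch : (ε :: cs.map Prod.fst).IsChain (· ≠ ·))
    {n : ℕ → ℕ} (hn : ∀ i, 1 ≤ n i) (i : ℕ) :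
    zigF u (List.replicate (i + 1) ε ++ inst cs n) = 0 := by
  refine h.zigF_eq_zero fun h1 => cons_inst_notMem hch h.ne_zero hn (mem_Zcl_of_sublist ?_ h1)
  rw [List.replicate_succ, List.cons_append]
  exact (List.sublist_append_right _ _).cons_cons ε

lemma inst_inf_eq_cons {ε : Bool} {cs : List (Bool × ℕ∞)} {n : ℕ → ℕ} (hn : 1 ≤ n 0) :
    inst ((ε, ⊤) :: cs) n = ε :: inst ((ε, ⊤) :: cs) (n - Pi.single 0 1) := by
  obtain ⟨k, hk⟩ := Nat.exists_eq_add_of_le' hn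
  simp [inst_cons, hk, List.replicate_succ]

lemma WeightedFinite.zigF_inst_zero {ε : Bool} {x : ℝ} {cs : List (Bool × ℕ∞)}
    {u : List (Bool × ℝ)} {n : ℕ → ℕ} (hn : 1 ≤ n 0)
    (hf : ∀ i, zigF u (List.replicate (i + 1) ε ++ inst cs fun i => n (i + 1)) = 0) :
    zigF ((ε, x) :: u) (inst ((ε, ⊤) :: cs) (n + Pi.single 0 1))
      = x * zigF ((ε, x) :: u) (inst ((ε, ⊤) :: cs) n) := by
  have e : (fun i => (n + Pi.single 0 1 : ℕ → ℕ) (i + 1)) = fun i => n (i + 1) := by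
    funext i
    simp
  rw [zigF_cons_inst hn hf, zigF_cons_inst (by simp) (by rw [e]; exact hf), e]
  simp only [Pi.add_apply, Pi.single_eq_same]
  ring

/-- Lengthening an infinite cluster of a generic word multiplies `F` by a constant. -/
lemma WeightedFinite.exists_scaling {cs : List (Bool × ℕ∞)} {u : List (Bool × ℝ)}
    (h : WeightedFinite cs u) (j : ℕ) (hj : (cs.getD j (true, 1)).2 = ⊤) :
    ∃ ω : ℝ, 0 < ω ∧ ∀ n : ℕ → ℕ, 1 ≤ n 0 → (∀ i, 2 ≤ n (i + 1)) →
      zigF u (inst cs (n + Pi.single j 1)) = ω * zigF u (inst cs n) := by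
  induction h generalizing j with
  | single ε x hx =>
    have : j = 0 := by
      have := getD_two_ne_top hj
      simpa using this
    subst this
    exact ⟨x, hx, fun n h0 _ => zigF_inst_zero h0 fun i => by simp [zigF]⟩
  | inf ε x cs u hx h ih =>
    have hz : ∀ n : ℕ → ℕ, (∀ i, 2 ≤ n (i + 1)) → ∀ i,
        zigF u (List.replicate (i + 1) ε ++ inst ((!ε, ⊤) :: cs) fun i => n (i + 1)) = 0 :=
      fun n hn i => h.zigF_replicate_inst (List.isChain_cons_cons.2 ⟨by simp, h.isChain⟩)
        (fun i => by have := hn i; omega) i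
    cases j with
    | zero => exact ⟨x, hx, fun n h0 hn => zigF_inst_zero h0 (hz n hn)⟩
    | succ j =>
      obtain ⟨ω, hω, hs⟩ := ih j (by simpa using hj)
      refine ⟨ω, hω, fun n h0 hn => ?_⟩
      have hn' : ∀ i, 2 ≤ (n + Pi.single (j + 1) 1 : ℕ → ℕ) (i + 1) :=
        fun i => (hn i).trans (Nat.le_add_right _ _)
      have key : ∀ n : ℕ → ℕ, 1 ≤ n 0 → (∀ i, 2 ≤ n (i + 1)) →
          zigF ((ε, x) :: u) (inst ((ε, ⊤) :: (!ε, ⊤) :: cs) n) = x ^ n 0 *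
            (zigF u (inst ((!ε, ⊤) :: cs) fun i => n (i + 1)) + x * zigF u
              (inst ((!ε, ⊤) :: cs) ((fun i => n (i + 1)) - Pi.single 0 1))) := by
        intro n h0 hn
        rw [zigF_cons_inst h0 (hz n hn)]
        congr 2
        rw [inst_inf_eq_cons (n := fun i => n (i + 1)) (by have := hn 0; omega)]
        simp [headSum]
      rw [key n h0 hn, key _ (by simpa using h0) hn', add_single_succ, hs]
      · have : (((fun i => n (i + 1)) + Pi.single j 1 : ℕ → ℕ) - Pi.single 0 1)
            = ((fun i => n (i + 1)) - Pi.single 0 1) + Pi.single j 1 := by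
          funext i
          have := hn 0
          rcases i with _ | i
          · simp only [Pi.sub_apply, Pi.add_apply, Pi.single_eq_same, zero_add] at this ⊢
            omega
          · simp
        rw [this, hs]
        · simp only [Pi.add_apply, Pi.single_apply]
          simp
          ring
        · have := hn 0
          simp only [zero_add] at this
          simp
          omega
        · intro i
          simpa using hn (i + 1)
      · have := hn 0
        simp at this ⊢
        omega
      · exact fun i => hn (i + 1)
  | sep ε x cs u hx h ih =>
    have hch := List.isChain_cons_cons (R := (· ≠ ·)).2 ⟨(by simp : (!ε) ≠ ε), h.isChain⟩
    have hz1 : ∀ n : ℕ → ℕ, (∀ i, 2 ≤ n (i + 1)) →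
        ∀ i, zigF u (List.replicate (i + 1) (!ε) ++ inst ((ε, ⊤) :: cs) fun i => n (i + 2)) = 0 :=
      fun n hn i => h.zigF_replicate_inst hch (fun i => le_trans one_le_two (hn (i + 1))) i
    have e : ∀ n : ℕ → ℕ, (inst ((!ε, 1) :: (ε, ⊤) :: cs) fun i => n (i + 1))
        = (!ε) :: inst ((ε, ⊤) :: cs) fun i => n (i + 2) := by
      intro n
      rw [inst_cons]
      simp
    have hz : ∀ n : ℕ → ℕ, (∀ i, 2 ≤ n (i + 1)) → ∀ i, zigF u
        (List.replicate (i + 1) ε ++ inst ((!ε, 1) :: (ε, ⊤) :: cs) fun i => n (i + 1)) = 0 := by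
      intro n hn i
      refine h.zigF_eq_zero fun h1 => cons_inst_notMem (n := fun i => n (i + 2)) hch h.ne_zero
        (fun i => le_trans one_le_two (hn (i + 1))) (mem_Zcl_of_sublist ?_ h1)
      rw [e]
      exact List.sublist_append_right _ _
    cases j with
    | zero => exact ⟨x, hx, fun n h0 hn => zigF_inst_zero h0 (hz n hn)⟩
    | succ j =>
    cases j with
    | zero => simp at hj
    | succ j =>
      obtain ⟨ω, hω, hs⟩ := ih j (by simpa using hj)
      refine ⟨ω, hω, fun n h0 hn => ?_⟩
      have hn' : ∀ i, 2 ≤ (n + Pi.single (j + 1 + 1) 1 : ℕ → ℕ) (i + 1) :=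
        fun i => (hn i).trans (Nat.le_add_right _ _)
      have key : ∀ n : ℕ → ℕ, 1 ≤ n 0 → (∀ i, 2 ≤ n (i + 1)) →
          zigF ((ε, x) :: u) (inst ((ε, ⊤) :: (!ε, 1) :: (ε, ⊤) :: cs) n) = x ^ n 0 *
            (x * zigF u (inst ((ε, ⊤) :: cs) fun i => n (i + 2))) := by
        intro n h0 hn
        rw [zigF_cons_inst h0 (hz n hn), e]
        have := hz1 n hn 0
        simp at this
        simp [headSum, this]
      have e2 : (fun i => (n + Pi.single (j + 1 + 1) 1 : ℕ → ℕ) (i + 2))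
          = (fun i => n (i + 2)) + Pi.single j 1 := by
        funext i
        simp [Pi.single_apply]
      rw [key n h0 hn, key _ (by simpa using h0) hn', e2, hs _ _ fun i => hn (i + 2)]
      · simp only [Pi.add_apply, Pi.single_apply]
        simp
        ring
      · have := hn 1
        simp at this ⊢
        omega

/-- A definite proportion of the value of `f` at `a` is carried by words of `G` that contain `a`
and have `L` more letters. -/
def Spreads (G : Set BW) (f : BW → ℝ) (L : ℕ) (δ : ℝ) (a : BW) : Prop :=
  ∃ B : Finset BW, (∀ b ∈ B, a.Sublist b ∧ b.length = a.length + L ∧ b ∈ G) ∧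
    δ * f a ≤ ∑ b ∈ B, f b

section HeadSum

variable {ε : Bool} {x : ℝ} {f : BW → ℝ}

lemma mul_headSum_le (hx : 0 < x) (hf : ∀ a, 0 ≤ f a) (a : BW) :
    x * headSum ε x f a ≤ headSum ε x f (ε :: a) := by
  simp only [headSum, if_true]
  exact mul_le_mul_of_nonneg_left (le_add_of_nonneg_left (hf a)) hx.le

lemma headSum_not_cons (a : BW) : headSum ε x f ((!ε) :: a) = x * f a := by
  simp [headSum]

lemma le_headSum_two (hx : 0 < x) (hf : ∀ a, 0 ≤ f a) (a : BW) :
    x ^ 3 * f a ≤ headSum ε x f (ε :: ε :: (!ε) :: a) := by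
  calc x ^ 3 * f a = x * (x * headSum ε x f ((!ε) :: a)) := by rw [headSum_not_cons]; ring
    _ ≤ x * headSum ε x f (ε :: (!ε) :: a) :=
      mul_le_mul_of_nonneg_left (mul_headSum_le hx hf _) hx.le
    _ ≤ _ := mul_headSum_le hx hf _

lemma le_headSum_three (hx : 0 < x) (hf : ∀ a, 0 ≤ f a) (a : BW) :
    x ^ 4 * f a ≤ headSum ε x f (ε :: ε :: ε :: (!ε) :: a) := by
  calc x ^ 4 * f a = x * (x ^ 3 * f a) := by ring
    _ ≤ x * headSum ε x f (ε :: ε :: (!ε) :: a) :=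
      mul_le_mul_of_nonneg_left (le_headSum_two hx hf _) hx.le
    _ ≤ _ := mul_headSum_le hx hf _

lemma headSum_spreads {G G' : Set BW} {L : ℕ} {δ : ℝ} (hx : 0 < x) (hf : ∀ a, 0 ≤ f a)
    (hG : ∀ b ∈ G, ε :: b ∈ G) (hG' : ∀ b ∈ G', ε :: ε :: (!ε) :: b ∈ G)
    (hsp : ∀ a, Spreads G' f L δ a) {b₀ : BW} (hb₀ : b₀ ∈ G') (hlen : b₀.length + 1 = L)
    (hδ : δ ≤ f b₀) (a : BW) :
    ∃ B : Finset BW, (∀ b ∈ B, a.Sublist b ∧ b.length = a.length + (L + 3) ∧ b ∈ G ∧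
      ∃ c, b = ε :: ε :: ε :: c) ∧ x ^ 3 * δ * headSum ε x f a ≤ ∑ b ∈ B, headSum ε x f b := by
  induction a with
  | nil =>
    refine ⟨{ε :: ε :: ε :: (!ε) :: b₀}, ?_, ?_⟩
    · simp only [Finset.mem_singleton, forall_eq]
      refine ⟨List.nil_sublist _, ?_, hG _ (hG' _ hb₀), _, rfl⟩
      simp
      omega
    · rw [Finset.sum_singleton]
      refine le_trans ?_ (le_headSum_three hx hf b₀)
      calc x ^ 3 * δ * headSum ε x f [] = x ^ 4 * δ := by simp only [headSum]; ring
        _ ≤ _ := mul_le_mul_of_nonneg_left hδ (by positivity)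
  | cons y a ih =>
    obtain ⟨B, hB, hsum⟩ := ih
    obtain ⟨C, hC, hCsum⟩ := hsp a
    set C' := C.image fun b => ε :: ε :: ε :: (!ε) :: b with hC'
    have hC'mem : ∀ b ∈ C', (y :: a).Sublist b ∧ b.length = (y :: a).length + (L + 3) ∧ b ∈ G ∧
        ∃ c, b = ε :: ε :: ε :: c := by
      intro b hb
      obtain ⟨b, hb', rfl⟩ := Finset.mem_image.1 hb
      obtain ⟨h1, h2, h3⟩ := hC b hb'
      refine ⟨?_, ?_, hG _ (hG' _ h3), _, rfl⟩
      · by_cases hy : y = ε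
        · subst hy
          exact (((h1.cons _).cons _).cons _).cons_cons y
        · obtain rfl : y = !ε := by cases y <;> cases ε <;> simp_all
          exact (((h1.cons_cons _).cons _).cons _).cons _
      · simp
        omega
    have hC'sum : x ^ 4 * (δ * f a) ≤ ∑ b ∈ C', headSum ε x f b := by
      rw [hC', Finset.sum_image (by intro b _ c _ h; simpa using h)]
      calc x ^ 4 * (δ * f a) ≤ x ^ 4 * ∑ b ∈ C, f b :=
            mul_le_mul_of_nonneg_left hCsum (by positivity)
        _ ≤ _ := by
          rw [Finset.mul_sum]
          exact Finset.sum_le_sum fun b _ => le_headSum_three hx hf b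
    by_cases hy : y = ε
    · subst hy
      have hdis : Disjoint C' (B.image (y :: ·)) := by
        rw [Finset.disjoint_left]
        intro b hb hb'
        obtain ⟨b, _, rfl⟩ := Finset.mem_image.1 hb
        obtain ⟨b', hb', h⟩ := Finset.mem_image.1 hb'
        obtain ⟨c, rfl⟩ := (hB b' hb').2.2.2
        simp at h
      refine ⟨C' ∪ B.image (y :: ·), ?_, ?_⟩
      · intro b hb
        rcases Finset.mem_union.1 hb with hb | hb
        · exact hC'mem b hb
        · obtain ⟨b, hb', rfl⟩ := Finset.mem_image.1 hb
          obtain ⟨h1, h2, h3, c, rfl⟩ := hB b hb'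
          refine ⟨h1.cons_cons y, ?_, hG _ h3, _, rfl⟩
          simp at h2 ⊢
          omega
      · have he : ∑ b ∈ B.image (y :: ·), headSum y x f b = ∑ b ∈ B, headSum y x f (y :: b) :=
          Finset.sum_image (by intro b _ c _ h; simpa using h)
        rw [Finset.sum_union hdis, he]
        have h1 : x * (x ^ 3 * δ * headSum y x f a) ≤ ∑ b ∈ B, headSum y x f (y :: b) :=
          calc _ ≤ x * ∑ b ∈ B, headSum y x f b := mul_le_mul_of_nonneg_left hsum hx.le
            _ ≤ _ := by
              rw [Finset.mul_sum]
              exact Finset.sum_le_sum fun b _ => mul_headSum_le hx hf b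
        refine le_trans (le_of_eq ?_) (add_le_add hC'sum h1)
        simp only [headSum, if_true]
        ring
    · refine ⟨C', hC'mem, le_trans (le_of_eq ?_) hC'sum⟩
      simp only [headSum, if_neg hy]
      ring

lemma zigF_cons_spreads {G G' : Set BW} {L : ℕ} {δ : ℝ} {u : List (Bool × ℝ)} (hx : 0 < x)
    (hf : ∀ a, 0 ≤ zigF u a)
    (hG : ∀ b ∈ G, ε :: b ∈ G) (hG' : ∀ b ∈ G', ε :: ε :: (!ε) :: b ∈ G)
    (hsp : ∀ a, Spreads G' (zigF u) L δ a) (hb₀ : ∃ b₀ ∈ G', b₀.length + 1 = L ∧ δ ≤ zigF u b₀) :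
    (∃ b₀ ∈ G, b₀.length + 1 = L + 3 ∧ x ^ 3 * δ ≤ zigF ((ε, x) :: u) b₀) ∧
      ∀ a, Spreads G (zigF ((ε, x) :: u)) (L + 3) (x ^ 3 * δ) a := by
  obtain ⟨b₀, hb₀, hlen, hδ⟩ := hb₀
  refine ⟨⟨ε :: ε :: (!ε) :: b₀, hG' _ hb₀, by simp; omega, ?_⟩, fun a => ?_⟩
  · exact (mul_le_mul_of_nonneg_left hδ (by positivity)).trans
      ((le_headSum_two hx hf b₀).trans (le_add_of_nonneg_left (hf _)))
  · obtain ⟨B, hB, hBsum⟩ := headSum_spreads hx hf hG hG' hsp hb₀ hlen hδ a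
    obtain ⟨C, hC, hCsum⟩ := hsp a
    have hdis : Disjoint (C.image fun b => ε :: ε :: (!ε) :: b) B := by
      rw [Finset.disjoint_left]
      intro b hb hb'
      obtain ⟨b, _, rfl⟩ := Finset.mem_image.1 hb
      obtain ⟨c, h⟩ := (hB _ hb').2.2.2
      simp at h
    refine ⟨(C.image fun b => ε :: ε :: (!ε) :: b) ∪ B, fun b hb => ?_, ?_⟩
    · rcases Finset.mem_union.1 hb with hb | hb
      · obtain ⟨b, hb', rfl⟩ := Finset.mem_image.1 hb
        obtain ⟨h1, h2, h3⟩ := hC b hb'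
        refine ⟨((h1.cons _).cons _).cons _, ?_, hG' _ h3⟩
        simp
        omega
      · obtain ⟨h1, h2, h3, -⟩ := hB b hb
        exact ⟨h1, h2, h3⟩
    · rw [Finset.sum_union hdis, Finset.sum_image (by intro b _ c _ h; simpa using h)]
      have h1 : x ^ 3 * (δ * zigF u a)
          ≤ ∑ b ∈ C, zigF ((ε, x) :: u) (ε :: ε :: (!ε) :: b) :=
        calc _ ≤ x ^ 3 * ∑ b ∈ C, zigF u b := mul_le_mul_of_nonneg_left hCsum (by positivity)
          _ ≤ _ := by
            rw [Finset.mul_sum]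
            exact Finset.sum_le_sum fun b _ =>
              (le_headSum_two hx hf b).trans (le_add_of_nonneg_left (hf _))
      have h2 : x ^ 3 * δ * headSum ε x (zigF u) a ≤ ∑ b ∈ B, zigF ((ε, x) :: u) b :=
        hBsum.trans (Finset.sum_le_sum fun b _ => le_add_of_nonneg_left (hf _))
      refine le_trans (le_of_eq ?_) (add_le_add h1 h2)
      simp only [zigF]
      ring

end HeadSum

lemma zigF_single_replicate (ε : Bool) (x : ℝ) (k : ℕ) :
    zigF [(ε, x)] (List.replicate k ε) = x ^ (k + 1) := by
  simp only [zigF, zero_add]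
  induction k with
  | zero => simp [headSum]
  | succ k ih =>
    rw [List.replicate_succ]
    simp only [headSum, if_true, zero_add] at ih ⊢
    rw [ih]
    ring

lemma WeightedFinite.exists_spreads {cs : List (Bool × ℕ∞)} {u : List (Bool × ℝ)}
    (h : WeightedFinite cs u) : ∃ (L : ℕ) (δ : ℝ), 0 < δ ∧
      (∃ b₀ ∈ Generic cs, b₀.length + 1 = L ∧ δ ≤ zigF u b₀) ∧
        ∀ a, Spreads (Generic cs) (zigF u) L δ a := by
  induction h with
  | single ε x hx =>
    have hgen : ∀ k, List.replicate (k + 2) ε ∈ Generic [(ε, ⊤)] := fun k =>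
      ⟨fun _ => k + 2, fun _ => Nat.le_add_left _ _, by simp [inst_cons, inst_nil]⟩
    refine ⟨3, x ^ 3, by positivity, ⟨List.replicate 2 ε, hgen 0, by simp, ?_⟩, fun a => ?_⟩
    · rw [zigF_single_replicate]
    · by_cases ha : a ∈ Zcl [(ε, ⊤)]
      · obtain ⟨N, hN⟩ := ha
        obtain ⟨k, -, rfl⟩ : ∃ k ≤ N, a = List.replicate k ε := by
          simpa [clWord, List.sublist_replicate_iff] using hN
        refine ⟨{List.replicate (k + 3) ε}, ?_, ?_⟩
        · simp only [Finset.mem_singleton, forall_eq]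
          exact ⟨(List.replicate_sublist_replicate ε).2 (by omega), by simp, hgen (k + 1)⟩
        · rw [Finset.sum_singleton, zigF_single_replicate, zigF_single_replicate]
          exact le_of_eq (by ring)
      · refine ⟨∅, by simp, ?_⟩
        rw [(WeightedFinite.single ε x hx).zigF_eq_zero ha]
        simp
  | inf ε x cs u hx h ih =>
    obtain ⟨L, δ, hδ, hb, hsp⟩ := ih
    exact ⟨L + 3, x ^ 3 * δ, by positivity, zigF_cons_spreads hx h.zigF_nonneg
      (fun b => generic_cons_self)
      (fun b hb => generic_cons_inf (generic_cons_self hb)) hsp hb⟩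
  | sep ε x cs u hx h ih =>
    obtain ⟨L, δ, hδ, hb, hsp⟩ := ih
    exact ⟨L + 3, x ^ 3 * δ, by positivity, zigF_cons_spreads hx h.zigF_nonneg
      (fun b => generic_cons_self)
      (fun b hb => generic_cons_inf (generic_cons_one hb)) hsp hb⟩

/-- The list `B 0 ++ C 0 ++ B 1 ++ ⋯ ++ C (k - 1) ++ B k`. -/
def asm {α : Type*} : (k : ℕ) → (Fin (k + 1) → List α) → (Fin k → List α) → List α
  | 0, B, _ => B 0
  | k + 1, B, C => B 0 ++ (C 0 ++ asm k (fun j => B j.succ) fun i => C i.succ)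

section Asm

variable {α : Type*}

lemma asm_eq (k : ℕ) (B : Fin (k + 1) → List α) (C : Fin k → List α) :
    B 0 ++ (List.ofFn fun i : Fin k => C i ++ B i.succ).flatten = asm k B C := by
  induction k with
  | zero => simp [asm]
  | succ k ih => simp [asm, List.ofFn_succ, ← ih]

lemma asm_sublist {k : ℕ} {B B' : Fin (k + 1) → List α} {C C' : Fin k → List α}
    (hB : ∀ j, (B j).Sublist (B' j)) (hC : ∀ i, (C i).Sublist (C' i)) :
    (asm k B C).Sublist (asm k B' C') := by
  induction k with
  | zero => exact hB 0
  | succ k ih =>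
    exact (hB 0).append ((hC 0).append (ih (fun j => hB j.succ) fun i => hC i.succ))

lemma exists_asm_of_sublist {k : ℕ} {B : Fin (k + 1) → List α} {C : Fin k → List α} {l : List α}
    (h : l.Sublist (asm k B C)) : ∃ B' C', (∀ j, (B' j).Sublist (B j)) ∧
      (∀ i, (C' i).Sublist (C i)) ∧ l = asm k B' C' := by
  induction k generalizing l with
  | zero => exact ⟨fun _ => l, C, fun j => by rwa [Fin.fin_one_eq_zero j], fun _ => .refl _, rfl⟩
  | succ k ih =>
    obtain ⟨l₁, l₂, rfl, h1, h2⟩ := List.sublist_append_iff.1 h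
    obtain ⟨l₂, l₃, rfl, h2', h3⟩ := List.sublist_append_iff.1 h2
    obtain ⟨B', C', hB', hC', rfl⟩ := ih h3
    exact ⟨Fin.cons l₁ B', Fin.cons l₂ C', Fin.cases h1 hB', Fin.cases h2' hC', by simp [asm]⟩

lemma length_asm (k : ℕ) (B : Fin (k + 1) → List α) (C : Fin k → List α) :
    (asm k B C).length = ∑ j, (B j).length + ∑ i, (C i).length := by
  induction k with
  | zero => simp [asm]
  | succ k ih =>
    rw [Fin.sum_univ_succ, Fin.sum_univ_succ (fun i => (C i).length)]
    simp only [asm, List.length_append, ih]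
    omega

lemma asm_update_split (k : ℕ) (B : Fin (k + 1) → List α) (C : Fin k → List α)
    (j : Fin (k + 1)) : ∃ pre post, (∀ X, asm k (Function.update B j X) C = pre ++ (X ++ post)) ∧
      ((j : ℕ) = 0 → pre = []) ∧ ((j : ℕ) = k → post = []) := by
  induction k with
  | zero =>
    refine ⟨[], [], fun X => ?_, by simp, by simp⟩
    rw [Fin.fin_one_eq_zero j]
    simp [asm]
  | succ k ih =>
    cases j using Fin.cases with
    | zero =>
      refine ⟨[], C 0 ++ asm k (fun j => B j.succ) fun i => C i.succ, fun X => ?_, by simp,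
        by simp⟩
      simp [asm]
    | succ j =>
      obtain ⟨pre, post, h1, h2, h3⟩ := ih (fun j => B j.succ) (fun i => C i.succ) j
      refine ⟨B 0 ++ (C 0 ++ pre), post, fun X => ?_, by simp, fun h => h3 (by simpa using h)⟩
      have : (fun j' : Fin (k + 1) => Function.update B j.succ X j'.succ)
          = Function.update (fun j => B j.succ) j X := by
        funext j'
        by_cases hj : j' = j
        · subst hj
          simp
        · simp [hj]
      simp [asm, this, h1, (Fin.succ_ne_zero j).symm]

lemma asm_rigid_aux {k : ℕ} {B : Fin (k + 1) → List α} {c c' e : List α} {C C' : Fin k → List α}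
    (hB : ∀ j : Fin (k + 1), (j : ℕ) ≠ k → B j ≠ []) (he : e ≠ []) (hc : c' = c ++ e)
    (h : asm k B C = e ++ asm k B C') :
    ∃ j, B j ≠ [] ∧ (c ++ asm k B C).Sublist
      (c' ++ asm k (Function.update B j (B j).tail) C) := by
  cases k with
  | zero =>
    have := congrArg List.length h
    simp [asm, he] at this
  | succ k =>
    have hB0 := hB 0 (by simp)
    obtain ⟨y, b, hb⟩ := List.exists_cons_of_ne_nil hB0
    obtain ⟨z, e, rfl⟩ := List.exists_cons_of_ne_nil he
    refine ⟨0, hB0, ?_⟩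
    simp only [asm, hb, List.cons_append, List.cons.injEq] at h
    obtain ⟨rfl, h⟩ := h
    simp only [asm, hb, Function.update_self, List.tail_cons, List.cons_append, hc,
      List.append_assoc, Function.update_of_ne (Fin.succ_ne_zero _)]
    exact List.Sublist.append_left ((List.sublist_append_right _ _).cons_cons _) _

lemma asm_rigid {k : ℕ} {B : Fin (k + 1) → List α} {C C' : Fin k → List α}
    (hB : ∀ j : Fin (k + 1), (j : ℕ) ≠ 0 → (j : ℕ) ≠ k → B j ≠ [])
    (h : asm k B C = asm k B C') (hne : C ≠ C') :
    ∃ j C'', B j ≠ [] ∧ (∀ i, C'' i = C i ∨ C'' i = C' i) ∧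
      (asm k B C).Sublist (asm k (Function.update B j (B j).tail) C'') := by
  induction k with
  | zero => exact absurd (Subsingleton.elim _ _) hne
  | succ k ih =>
    have lift : ∀ (j : Fin (k + 1)) (X : List α) (D : Fin (k + 1) → List α),
        asm (k + 1) (Function.update B j.succ X) D = B 0 ++ (D 0 ++ asm k
          (Function.update (fun j => B j.succ) j X) fun i => D i.succ) := by
      intro j X D
      have : (fun j' : Fin (k + 1) => Function.update B j.succ X j'.succ)
          = Function.update (fun j => B j.succ) j X := by
        funext j'
        by_cases hj : j' = j
        · subst hj
          simp
        · simp [hj]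
      simp [asm, this, (Fin.succ_ne_zero j).symm]
    have hB' : ∀ j : Fin (k + 1), (j : ℕ) ≠ k → B j.succ ≠ [] := fun j hj =>
      hB j.succ (by simp) (by simpa using hj)
    have h' := h
    simp only [asm, List.append_cancel_left_eq] at h
    by_cases h0 : C 0 = C' 0
    · rw [h0, List.append_cancel_left_eq] at h
      obtain ⟨j, C'', h1, h2, h3⟩ := ih (fun j _ => hB' j) h fun h1 => hne (by
        funext i
        cases i using Fin.cases with
        | zero => exact h0
        | succ i => exact congrFun h1 i)
      refine ⟨j.succ, Fin.cons (C 0) C'', h1, Fin.cases (by simp) (by simpa using h2), ?_⟩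
      rw [lift]
      simp only [asm, Fin.cons_zero, Fin.cons_succ]
      exact (h3.append_left _).append_left _
    · rcases List.append_eq_append_iff.1 h with ⟨e, he, h1⟩ | ⟨e, he, h1⟩
      · obtain ⟨j, h2, h3⟩ := asm_rigid_aux hB' (fun h => h0 (by simpa [h] using he.symm)) he h1
        refine ⟨j.succ, Fin.cons (C' 0) fun i => C i.succ, h2,
          Fin.cases (by simp) (by simp), ?_⟩
        rw [lift]
        simp only [asm, Fin.cons_zero, Fin.cons_succ]
        exact h3.append_left _
      · obtain ⟨j, h2, h3⟩ := asm_rigid_aux hB' (fun h => h0 (by simpa [h] using he)) he h1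
        refine ⟨j.succ, Fin.cons (C 0) fun i => C' i.succ, h2,
          Fin.cases (by simp) (by simp), ?_⟩
        rw [lift, h']
        simp only [asm, Fin.cons_zero, Fin.cons_succ]
        exact h3.append_left _

end Asm

lemma clWord_append (cs cs' : List (Bool × ℕ∞)) (N : ℕ) :
    clWord (cs ++ cs') N = clWord cs N ++ clWord cs' N := by
  simp [clWord]

lemma clWord_asm (k : ℕ) (A : Fin (k + 1) → List (Bool × ℕ∞)) (C : Fin k → List (Bool × ℕ∞))
    (N : ℕ) :
    clWord (asm k A C) N = asm k (fun j => clWord (A j) N) fun i => clWord (C i) N := by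
  induction k with
  | zero => rfl
  | succ k ih => simp [asm, clWord_append, ih]

lemma inst_eq_flangeWord {cs : List (Bool × ℕ∞)} (h : ∀ c ∈ cs, c.2 ≠ ⊤) (n : ℕ → ℕ) :
    inst cs n = flangeWord cs := by
  induction cs generalizing n with
  | nil => rfl
  | cons c cs ih =>
    rw [inst_cons, if_neg (h c (by simp)), ih fun c hc => h c (by simp [hc])]
    simp [flangeWord]

lemma infSigns_append (cs cs' : List (Bool × ℕ∞)) :
    infSigns (cs ++ cs') = infSigns cs ++ infSigns cs' := by
  simp [infSigns]

lemma infSigns_eq_nil {cs : List (Bool × ℕ∞)} (h : ∀ c ∈ cs, c.2 ≠ ⊤) : infSigns cs = [] := by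
  simpa [infSigns] using h

lemma length_infSigns_asm {k : ℕ} {A : Fin (k + 1) → List (Bool × ℕ∞)}
    {C : Fin k → List (Bool × ℕ∞)} (hA : ∀ j, ∀ c ∈ A j, c.2 ≠ ⊤) :
    (infSigns (asm k A C)).length = ∑ i, (infSigns (C i)).length := by
  induction k with
  | zero => simp [asm, infSigns_eq_nil (hA 0)]
  | succ k ih =>
    simp [asm, infSigns_append, infSigns_eq_nil (hA 0), Fin.sum_univ_succ,
      ih fun j => hA j.succ]

lemma generic_flangeWord {cs : List (Bool × ℕ∞)} (h : ∀ c ∈ cs, c.2 ≠ ⊤) :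
    flangeWord cs ∈ Generic cs :=
  ⟨fun _ => 2, fun _ => le_rfl, (inst_eq_flangeWord h _).symm⟩

lemma generic_asm {k : ℕ} {A : Fin (k + 1) → List (Bool × ℕ∞)} {C : Fin k → List (Bool × ℕ∞)}
    {α : Fin (k + 1) → BW} {m : Fin k → BW} (hα : ∀ j, α j ∈ Generic (A j))
    (hm : ∀ i, m i ∈ Generic (C i)) : asm k α m ∈ Generic (asm k A C) := by
  induction k with
  | zero => exact hα 0
  | succ k ih =>
    exact generic_append (hα 0)
      (generic_append (hm 0) (ih (fun j => hα j.succ) fun i => hm i.succ))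

/-- The positions of the sections inside `asm k A C`. -/
lemma exists_offsets {k : ℕ} {A : Fin (k + 1) → List (Bool × ℕ∞)}
    {C : Fin k → List (Bool × ℕ∞)} (hA : ∀ j, ∀ c ∈ A j, c.2 ≠ ⊤) :
    ∃ o : Fin k → ℕ,
      (∀ n, inst (asm k A C) n
        = asm k (fun j => flangeWord (A j)) fun i => inst (C i) fun q => n (q + o i)) ∧
      (∀ p, ((asm k A C).getD p (true, 1)).2 = ⊤ → ∃ i q, p = q + o i ∧
        ((C i).getD q (true, 1)).2 = ⊤) ∧
      ∀ i i' q q', q < (C i).length → q' < (C i').length → q + o i = q' + o i' → i = i' := by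
  induction k with
  | zero =>
    refine ⟨fun i => i.elim0, fun n => inst_eq_flangeWord (hA 0) n, fun p hp => ?_,
      fun i => i.elim0⟩
    have h1 := getD_two_ne_top hp
    rw [List.getD_eq_getElem _ _ h1] at hp
    exact absurd hp (hA 0 _ (List.getElem_mem h1))
  | succ k ih =>
    obtain ⟨o, h1, h2, h3⟩ := ih (A := fun j => A j.succ) (C := fun i => C i.succ)
      fun j => hA j.succ
    refine ⟨Fin.cons (A 0).length fun i => o i + (C 0).length + (A 0).length, fun n => ?_,
      fun p hp => ?_, fun i i' q q' hq hq' h => ?_⟩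
    · simp only [asm, inst_append, h1, inst_eq_flangeWord (hA 0), Fin.cons_zero, Fin.cons_succ,
        add_assoc]
    · rcases lt_or_ge p (A 0).length with hlt | hge
      · simp only [asm] at hp
        rw [List.getD_append _ _ _ _ hlt, List.getD_eq_getElem _ _ hlt] at hp
        exact absurd hp (hA 0 _ (List.getElem_mem hlt))
      · obtain ⟨p, rfl⟩ := Nat.exists_eq_add_of_le' hge
        simp only [asm] at hp
        rw [List.getD_append_right _ _ _ _ hge, Nat.add_sub_cancel] at hp
        rcases lt_or_ge p (C 0).length with hlt | hge'
        · rw [List.getD_append _ _ _ _ hlt] at hp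
          exact ⟨0, p, rfl, hp⟩
        · obtain ⟨p, rfl⟩ := Nat.exists_eq_add_of_le' hge'
          rw [List.getD_append_right _ _ _ _ hge', Nat.add_sub_cancel] at hp
          obtain ⟨i, q, rfl, hq⟩ := h2 p hp
          exact ⟨i.succ, q, by simp [add_assoc], hq⟩
    · cases i using Fin.cases with
      | zero =>
        cases i' using Fin.cases with
        | zero => rfl
        | succ i' =>
          simp only [Fin.cons_zero, Fin.cons_succ] at h
          omega
      | succ i =>
        cases i' using Fin.cases with
        | zero =>
          simp only [Fin.cons_zero, Fin.cons_succ] at h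
          omega
        | succ i' =>
          simp only [Fin.cons_succ] at h
          rw [h3 i i' q q' hq hq' (by omega)]

lemma sum_filter_lt_add_le {k : ℕ} (c : Fin k → ℕ) (i : Fin k) :
    ∑ i' ∈ Finset.univ.filter (· < i), c i' + c i ≤ ∑ i', c i' := by
  rw [add_comm, ← Finset.sum_insert (by simp)]
  exact Finset.sum_le_sum_of_subset (Finset.subset_univ _)

lemma sum_take_drop {k : ℕ} (c : Fin k → ℕ) (w : List ℝ) (hw : w.length = ∑ i, c i) :
    ∑ i, ((w.drop (∑ i' ∈ Finset.univ.filter (· < i), c i')).take (c i)).sum = w.sum := by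
  induction k generalizing w with
  | zero =>
    obtain rfl : w = [] := List.length_eq_zero_iff.1 (by simpa using hw)
    simp
  | succ k ih =>
    rw [Fin.sum_univ_succ] at hw ⊢
    have := ih (fun i => c i.succ) (w.drop (c 0)) (by simp [hw])
    simp only [sum_filter_lt_succ, List.drop_drop] at this ⊢
    rw [show (fun i => c i.succ) = c ∘ Fin.succ from rfl] at this
    simp only [Function.comp_def] at this
    rw [this]
    simp

lemma mem_asm {α : Type*} {k : ℕ} {B : Fin (k + 1) → List α} {C : Fin k → List α}
    (j : Fin (k + 1)) {x : α} (hx : x ∈ B j) : x ∈ asm k B C := by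
  obtain ⟨pre, post, h, -⟩ := asm_update_split k B C j
  have := h (B j)
  rw [Function.update_eq_self] at this
  simp [this, hx]

lemma decAt_append {cs pre post : List (Bool × ℕ∞)} {q : ℕ} (hq : q < cs.length) :
    decAt (pre ++ (cs ++ post)) (pre.length + q) = pre ++ (decAt cs q ++ post) := by
  have h : (pre ++ (cs ++ post)).getD (pre.length + q) (true, 1) = cs.getD q (true, 1) := by
    rw [List.getD_append_right _ _ _ _ (by omega), Nat.add_sub_cancel_left,
      List.getD_append _ _ _ _ hq]
  rw [decAt, decAt, h, List.set_append_right _ _ (by omega), Nat.add_sub_cancel_left,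
    List.set_append_left _ _ hq]

lemma exists_sublist_inst_decAt {cs : List (Bool × ℕ∞)} (h : ∀ c ∈ cs, c.2 ≠ ⊤) {α : BW}
    (hα : α.Sublist (flangeWord cs)) (hne : α ≠ flangeWord cs) :
    ∃ q < cs.length, ∀ N, α.Sublist (clWord (decAt cs q) N) := by
  rw [← inst_eq_flangeWord h 0] at hα hne
  obtain ⟨m, hm, rfl⟩ := exists_blockWord_of_sublist hα
  obtain ⟨q, hq, hlt⟩ : ∃ q < (cs.map Prod.fst).length, m q < mults cs 0 q := by
    by_contra! hle
    exact hne (blockWord_congr fun i hi => le_antisymm (hm i) (hle i hi))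
  have hfin : ∀ i < cs.length, (cs.getD i (true, 1)).2 ≠ ⊤ := fun i hi => by
    rw [List.getD_eq_getElem _ _ hi]
    exact h _ (List.getElem_mem hi)
  rw [List.length_map] at hq
  refine ⟨q, hq, fun N => ?_⟩
  rw [clWord_eq_inst, inst_decAt hq (hfin q hq)]
  refine blockWord_sublist fun i hi => ?_
  have he : ∀ i < cs.length, mults cs (fun _ => N) i = mults cs 0 i := fun i hi => by
    rw [mults, mults, if_neg (hfin i hi), if_neg (hfin i hi)]
  by_cases hiq : i = q
  · subst hiq
    rw [Function.update_self, he i hq]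
    omega
  · rw [Function.update_of_ne hiq, he i (by simpa using hi)]
    exact hm i

section SectionData

variable {t : Template}

lemma mem_Jt_of_sublist {a b : BW} (h : a.Sublist b) (hb : b ∈ Jt t) : a ∈ Jt t := by
  obtain ⟨p, hp, hb⟩ := hb
  exact ⟨p, hp, mem_Zcl_of_sublist h hb⟩

lemma Jt_subset_Zt : Jt t ⊆ Zt t := by
  rintro a ⟨p, hp, N, hN⟩
  refine ⟨N, hN.trans ?_⟩
  rw [clWord_eq_inst, clWord_eq_inst, inst_decAt hp.1 hp.2.1]
  refine blockWord_sublist fun i _ => ?_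
  by_cases hip : i = p
  · subst hip
    simp
  · rw [Function.update_of_ne hip]

variable (D : SectionData t)

lemma clusters_eq_asm : t.clusters = asm D.k D.A fun i => (D.T i).clusters := by
  rw [← asm_eq, D.concat]

lemma assemble_eq_asm (ℓ : Fin D.k → BW) :
    assemble D ℓ = asm D.k (fun j => flangeWord (D.A j)) ℓ := by
  rw [← asm_eq, assemble]

lemma clWord_eq_assemble (N : ℕ) :
    clWord t.clusters N = assemble D fun i => clWord (D.T i).clusters N := by
  rw [clusters_eq_asm D, clWord_asm, assemble_eq_asm]
  congr 1
  funext j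
  rw [clWord_eq_inst, inst_eq_flangeWord (D.finA j)]

lemma flangeWord_ne_nil (j : Fin (D.k + 1)) (h0 : (j : ℕ) ≠ 0) (hk : (j : ℕ) ≠ D.k) :
    flangeWord (D.A j) ≠ [] := by
  obtain ⟨c, cs, hc⟩ := List.exists_cons_of_ne_nil (D.interior_ne j h0 hk)
  have hmem : c ∈ D.A j := by simp [hc]
  have h1 : c.2 ≠ 0 := t.pos c (by
    rw [clusters_eq_asm D]
    exact mem_asm j hmem)
  have h2 : c.2.toNat ≠ 0 := fun h => (ENat.toNat_eq_zero.1 h).elim h1 (D.finA j c hmem)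
  simp [hc, flangeWord, h2]

lemma exists_isFlangePos (j : Fin (D.k + 1)) {q : ℕ} (hq : q < (D.A j).length) :
    ∃ p, IsFlangePos t p ∧ decAt t.clusters p
      = asm D.k (Function.update D.A j (decAt (D.A j) q)) fun i => (D.T i).clusters := by
  obtain ⟨pre, post, h, hpre, hpost⟩ := asm_update_split D.k D.A (fun i => (D.T i).clusters) j
  have ht : t.clusters = pre ++ (D.A j ++ post) := by
    rw [clusters_eq_asm D, ← h, Function.update_eq_self]
  have hget : ∀ q < (D.A j).length, t.clusters.getD (pre.length + q) (true, 1) ∈ D.A j := by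
    intro q hq
    rw [ht, List.getD_append_right _ _ _ _ (by omega), Nat.add_sub_cancel_left,
      List.getD_append _ _ _ _ hq, List.getD_eq_getElem _ _ hq]
    exact List.getElem_mem hq
  refine ⟨pre.length + q, ⟨by simp [ht]; omega, D.finA j _ (hget q hq), ?_⟩, by
    rw [h, ht, decAt_append hq]⟩
  rintro ⟨hp0, hp1, hone, hl, hr⟩
  have hlen : (D.A j).length = 1 := by
    by_contra hne
    rcases Nat.eq_zero_or_pos q with rfl | hq0
    · exact D.finA j _ (hget 1 (by omega)) (by simpa using hr)
    · exact D.finA j _ (hget (q - 1) (by omega))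
        (by rw [← Nat.add_sub_assoc hq0]; exact hl)
  obtain rfl : q = 0 := by omega
  obtain ⟨c, hc⟩ := List.length_eq_one_iff.1 hlen
  have h0 : (j : ℕ) ≠ 0 := fun h => by simp [hpre h] at hp0
  have hk : (j : ℕ) ≠ D.k := fun h => by
    rw [ht, hpost h] at hp1
    simp [hlen] at hp1
  have h2 := hget 0 hq
  rw [hc, List.mem_singleton] at h2
  refine D.interior_not_sep j h0 hk c.1 ?_
  rw [hc]
  congr 1
  exact Prod.ext rfl (by rw [← h2]; exact hone)

variable {D}

lemma exists_common_clWord {ℓ : Fin D.k → BW} (hℓ : ∀ i, ℓ i ∈ Zt (D.T i)) :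
    ∃ N, ∀ i, (ℓ i).Sublist (clWord (D.T i).clusters N) := by
  choose N hN using hℓ
  exact ⟨∑ i, N i, fun i => (hN i).trans
    (clWord_mono _ (Finset.single_le_sum (fun _ _ => Nat.zero_le _) (Finset.mem_univ i)))⟩

lemma assemble_sublist {ℓ ℓ' : Fin D.k → BW} (h : ∀ i, (ℓ i).Sublist (ℓ' i)) :
    (assemble D ℓ).Sublist (assemble D ℓ') := by
  rw [assemble_eq_asm, assemble_eq_asm]
  exact asm_sublist (fun j => .refl _) h

lemma assemble_mem_Zt {ℓ : Fin D.k → BW} (hℓ : ∀ i, ℓ i ∈ Zt (D.T i)) : assemble D ℓ ∈ Zt t := by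
  obtain ⟨N, hN⟩ := exists_common_clWord hℓ
  refine ⟨N, ?_⟩
  rw [clWord_eq_assemble D]
  exact assemble_sublist hN

lemma asm_mem_Jt {α : Fin (D.k + 1) → BW} {ℓ : Fin D.k → BW}
    (hα : ∀ j, (α j).Sublist (flangeWord (D.A j))) (hne : ∃ j, α j ≠ flangeWord (D.A j))
    (hℓ : ∀ i, ℓ i ∈ Zt (D.T i)) : asm D.k α ℓ ∈ Jt t := by
  obtain ⟨j, hj⟩ := hne
  obtain ⟨q, hq, hsub⟩ := exists_sublist_inst_decAt (D.finA j) (hα j) hj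
  obtain ⟨p, hp, hdec⟩ := exists_isFlangePos D j hq
  obtain ⟨N, hN⟩ := exists_common_clWord hℓ
  refine ⟨p, hp, N, ?_⟩
  rw [hdec, clWord_asm]
  refine asm_sublist (fun j' => ?_) hN
  by_cases hjj : j' = j
  · subst hjj
    rw [Function.update_self]
    exact hsub N
  · rw [Function.update_of_ne hjj, clWord_eq_inst, inst_eq_flangeWord (D.finA j')]
    exact hα j'

lemma exists_of_sublist_assemble {a : BW} {m : Fin D.k → BW} (hm : ∀ i, m i ∈ Zt (D.T i))
    (h : a.Sublist (assemble D m)) (ha : a ∉ Jt t) :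
    ∃ ℓ : Fin D.k → BW, (∀ i, (ℓ i).Sublist (m i)) ∧ a = assemble D ℓ := by
  rw [assemble_eq_asm] at h
  obtain ⟨α, ℓ, hα, hℓ, rfl⟩ := exists_asm_of_sublist h
  refine ⟨ℓ, hℓ, ?_⟩
  rw [assemble_eq_asm]
  congr 1
  by_contra hne
  exact ha (asm_mem_Jt hα (Function.ne_iff.1 hne) fun i => mem_Zcl_of_sublist (hℓ i) (hm i))

lemma exists_decompOf {a : BW} (ha : a ∈ Zt t) (haJ : a ∉ Jt t) :
    ∃ ℓ : Fin D.k → BW, decompOf D a ℓ := by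
  obtain ⟨N, hN⟩ := ha
  rw [clWord_eq_assemble D] at hN
  have hm : ∀ i, clWord (D.T i).clusters N ∈ Zt (D.T i) := fun i => ⟨N, .refl _⟩
  obtain ⟨ℓ, hℓ, rfl⟩ := exists_of_sublist_assemble hm hN haJ
  exact ⟨ℓ, fun i => mem_Zcl_of_sublist (hℓ i) (hm i), rfl⟩

lemma assemble_inj {ℓ ℓ' : Fin D.k → BW} (hℓ : ∀ i, ℓ i ∈ Zt (D.T i))
    (hℓ' : ∀ i, ℓ' i ∈ Zt (D.T i)) (haJ : assemble D ℓ ∉ Jt t)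
    (h : assemble D ℓ = assemble D ℓ') : ℓ = ℓ' := by
  by_contra hne
  rw [assemble_eq_asm, assemble_eq_asm] at h
  obtain ⟨j, ℓ'', hj, h1, h2⟩ := asm_rigid (flangeWord_ne_nil D) h hne
  rw [assemble_eq_asm] at haJ
  refine haJ (mem_Jt_of_sublist h2 (asm_mem_Jt (fun j' => ?_) ⟨j, ?_⟩ fun i => ?_))
  · by_cases hjj : j' = j
    · subst hjj
      rw [Function.update_self]
      exact List.tail_sublist _
    · rw [Function.update_of_ne hjj]
  · rw [Function.update_self]
    intro h3
    have := congrArg List.length h3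
    have h4 := List.length_pos_iff.2 hj
    rw [List.length_tail] at this
    omega
  · rcases h1 i with h | h <;> rw [h]
    · exact hℓ i
    · exact hℓ' i

lemma length_assemble (ℓ : Fin D.k → BW) :
    (assemble D ℓ).length = ∑ j, (flangeWord (D.A j)).length + ∑ i, (ℓ i).length := by
  rw [assemble_eq_asm, length_asm]

lemma update_mem_Zt {ℓ : Fin D.k → BW} (hℓ : ∀ i, ℓ i ∈ Zt (D.T i)) {i : Fin D.k} {m : BW}
    (hm : m ∈ Zt (D.T i)) (i' : Fin D.k) : Function.update ℓ i m i' ∈ Zt (D.T i') := by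
  by_cases h : i' = i
  · subst h
    rwa [Function.update_self]
  · rw [Function.update_of_ne h]
    exact hℓ i'

lemma mem_upFinset {S : Set BW} {a b : BW} : b ∈ upFinset S a ↔ b ∈ S ∧ CoveredBy a b := by
  simp [upFinset]

lemma coveredBy_assemble_update (ℓ : Fin D.k → BW) {i : Fin D.k} {m : BW}
    (hm : CoveredBy (ℓ i) m) :
    CoveredBy (assemble D ℓ) (assemble D (Function.update ℓ i m)) := by
  constructor
  · refine assemble_sublist fun i' => ?_
    by_cases h : i' = i
    · subst h
      rw [Function.update_self]
      exact hm.1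
    · rw [Function.update_of_ne h]
  · have h : ∑ x ∈ Finset.univ.erase i, (Function.update ℓ i m x).length
        = ∑ x ∈ Finset.univ.erase i, (ℓ x).length :=
      Finset.sum_congr rfl fun i' hi' => by rw [Function.update_of_ne (Finset.ne_of_mem_erase hi')]
    rw [length_assemble, length_assemble,
      ← Finset.add_sum_erase _ (fun x => (Function.update ℓ i m x).length) (Finset.mem_univ i),
      ← Finset.add_sum_erase _ (fun i => (ℓ i).length) (Finset.mem_univ i), Function.update_self,
      hm.2, h]
    omega

/-- Off `J(t)` the upper neighbours are obtained by enlarging one of the sections. -/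
lemma sum_upFinset_assemble {ℓ : Fin D.k → BW} (hℓ : ∀ i, ℓ i ∈ Zt (D.T i))
    (haJ : assemble D ℓ ∉ Jt t) {M : Type*} [AddCommMonoid M] (g : BW → M) :
    ∑ b ∈ upFinset (Zt t) (assemble D ℓ), g b
      = ∑ i, ∑ m ∈ upFinset (Zt (D.T i)) (ℓ i), g (assemble D (Function.update ℓ i m)) := by
  rw [Finset.sum_sigma']
  symm
  refine Finset.sum_bij (fun x _ => assemble D (Function.update ℓ x.1 x.2)) ?_ ?_ ?_
    (fun _ _ => rfl)
  · rintro ⟨i, m⟩ hx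
    have hm := mem_upFinset.1 (Finset.mem_sigma.1 hx).2
    exact mem_upFinset.2 ⟨assemble_mem_Zt (update_mem_Zt hℓ hm.1),
      coveredBy_assemble_update ℓ hm.2⟩
  · rintro ⟨i, m⟩ hx ⟨i', m'⟩ hx' h
    have hm := mem_upFinset.1 (Finset.mem_sigma.1 hx).2
    have hm' := mem_upFinset.1 (Finset.mem_sigma.1 hx').2
    have hne : ∀ {i : Fin D.k} {m : BW}, CoveredBy (ℓ i) m → m ≠ ℓ i := by
      rintro i m h rfl
      have := h.2
      omega
    have h1 := assemble_inj (update_mem_Zt hℓ hm.1) (update_mem_Zt hℓ hm'.1)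
      (fun hJ => haJ (mem_Jt_of_sublist (coveredBy_assemble_update ℓ hm.2).1 hJ)) h
    have hi : i = i' := by
      by_contra hii
      have := congrFun h1 i
      simp only at this
      rw [Function.update_self, Function.update_of_ne hii] at this
      exact hne hm.2 this
    subst hi
    have := congrFun h1 i
    simp only [Function.update_self] at this
    rw [this]
  · intro b hb
    obtain ⟨hbZ, hab⟩ := mem_upFinset.1 hb
    obtain ⟨m, hm, rfl⟩ := exists_decompOf (D := D) hbZ
      fun hJ => haJ (mem_Jt_of_sublist hab.1 hJ)
    obtain ⟨ℓ', hℓ', he⟩ := exists_of_sublist_assemble hm hab.1 haJ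
    obtain rfl := assemble_inj hℓ (fun i => mem_Zcl_of_sublist (hℓ' i) (hm i)) haJ he
    have hlen := hab.2
    rw [length_assemble, length_assemble] at hlen
    obtain ⟨i, -, hi⟩ : ∃ i ∈ Finset.univ, (ℓ i).length < (m i).length :=
      Finset.exists_lt_of_sum_lt (by omega)
    have h2 : ∀ i' ≠ i, (ℓ i').length = (m i').length ∧ (m i).length = (ℓ i).length + 1 := by
      intro i' hi'
      have h3 : ∑ x ∈ (Finset.univ.erase i).erase i', (ℓ x).length
          ≤ ∑ x ∈ (Finset.univ.erase i).erase i', (m x).length :=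
        Finset.sum_le_sum fun x _ => (hℓ' x).length_le
      rw [← Finset.add_sum_erase _ (fun i => (ℓ i).length) (Finset.mem_univ i),
        ← Finset.add_sum_erase _ (fun i => (m i).length) (Finset.mem_univ i),
        ← Finset.add_sum_erase _ (fun i => (ℓ i).length)
          (Finset.mem_erase.2 ⟨hi', Finset.mem_univ i'⟩),
        ← Finset.add_sum_erase _ (fun i => (m i).length)
          (Finset.mem_erase.2 ⟨hi', Finset.mem_univ i'⟩)]
        at hlen
      have := (hℓ' i').length_le
      omega
    have h4 : (m i).length = (ℓ i).length + 1 := by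
      have h3 : ∑ x ∈ Finset.univ.erase i, (ℓ x).length
          ≤ ∑ x ∈ Finset.univ.erase i, (m x).length :=
        Finset.sum_le_sum fun x _ => (hℓ' x).length_le
      rw [← Finset.add_sum_erase _ (fun i => (ℓ i).length) (Finset.mem_univ i),
        ← Finset.add_sum_erase _ (fun i => (m i).length) (Finset.mem_univ i)] at hlen
      omega
    have hup : m = Function.update ℓ i (m i) := by
      funext i'
      by_cases hi' : i' = i
      · subst hi'
        simp
      · rw [Function.update_of_ne hi']
        exact ((hℓ' i').eq_of_length (h2 i' hi').1).symm
    exact ⟨⟨i, m i⟩, Finset.mem_sigma.2 ⟨Finset.mem_univ _, mem_upFinset.2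
      ⟨hm i, hℓ' i, h4⟩⟩, by rw [← hup]⟩

end SectionData

lemma map_snd_zip_eq_take {α β : Type*} (l : List α) (l' : List β) :
    (l.zip l').map Prod.snd = l'.take l.length := by
  induction l generalizing l' with
  | nil => simp
  | cons x l ih =>
    cases l' with
    | nil => simp
    | cons y l' => simp [ih]

lemma exists_coveredBy_of_sublist {a b : BW} (h : a.Sublist b) (hlt : a.length < b.length) :
    ∃ c, CoveredBy a c ∧ c.Sublist b := by
  induction h with
  | slnil => simp at hlt
  | @cons l₁ l₂ x h _ =>
    exact ⟨x :: l₁, ⟨List.sublist_cons_self _ _, rfl⟩, h.cons_cons x⟩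
  | @cons_cons l₁ l₂ x h ih =>
    obtain ⟨c, hc, hcb⟩ := ih (by simpa using hlt)
    exact ⟨x :: c, ⟨hc.1.cons_cons x, by simp [hc.2]⟩, hcb.cons_cons x⟩

lemma exists_coveredBy_mem_Zcl {cs : List (Bool × ℕ∞)} {s : Bool} (hs : (s, ⊤) ∈ cs) {a : BW}
    (ha : a ∈ Zcl cs) : ∃ b ∈ Zcl cs, CoveredBy a b := by
  obtain ⟨N, hN⟩ := ha
  have hlen : a.length < (clWord cs (max N (a.length + 1))).length := by
    have h1 : List.replicate (max N (a.length + 1)) s ∈ cs.map fun c =>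
        List.replicate (if c.2 = ⊤ then max N (a.length + 1) else c.2.toNat) c.1 :=
      List.mem_map.2 ⟨_, hs, by simp⟩
    have h2 := (List.sublist_flatten_of_mem h1).length_le
    rw [List.length_replicate] at h2
    exact lt_of_lt_of_le (by omega) h2
  obtain ⟨c, hc, hcb⟩ := exists_coveredBy_of_sublist
    (hN.trans (clWord_mono cs (le_max_left _ _))) hlen
  exact ⟨c, ⟨_, hcb⟩, hc⟩

section SectionData

variable {t : Template} {D : SectionData t} {w : List ℝ}

lemma exists_coveredBy_mem_Jt {a : BW} (ha : a ∈ Jt t) : ∃ b ∈ Jt t, CoveredBy a b := by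
  obtain ⟨p, hp, ha⟩ := ha
  obtain ⟨⟨s, m⟩, hc, hm⟩ := t.hasInf
  simp only at hm
  subst hm
  obtain ⟨i, hi, hget⟩ := List.getElem_of_mem hc
  have hip : p ≠ i := by
    rintro rfl
    refine hp.2.1 ?_
    rw [List.getD_eq_getElem _ _ hi, hget]
  have hs : (s, ⊤) ∈ decAt t.clusters p := by
    rw [← hget]
    refine List.mem_iff_getElem.2 ⟨i, by simpa [decAt] using hi, ?_⟩
    simp [decAt, List.getElem_set_ne hip]
  obtain ⟨b, hb, hab⟩ := exists_coveredBy_mem_Zcl hs ha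
  exact ⟨b, ⟨p, hp, hb⟩, hab⟩

variable (D) in
lemma numInf_eq_sum : t.numInf = ∑ i, (infSigns (D.T i).clusters).length := by
  rw [← length_infSigns_asm D.finA, ← clusters_eq_asm D]
  simp [Template.numInf, infSigns]

lemma weightedFinite_vD (hlen : w.length = t.numInf) (hwpos : ∀ x ∈ w, 0 < x) (i : Fin D.k) :
    WeightedFinite (D.T i).clusters (vD D w i) := by
  refine .of_isFinite (isChain_map_fst (D.T i).alternating) (D.T i).ne (D.secFin i) ?_ ?_
  · rw [vD, List.map_fst_zip]
    have := sum_filter_lt_add_le (fun i => (infSigns (D.T i).clusters).length) i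
    rw [List.length_drop, hlen, numInf_eq_sum D, secOffset]
    omega
  · intro p hp
    exact hwpos _ (List.mem_of_mem_drop (List.of_mem_zip hp).2)

lemma sum_vD (hlen : w.length = t.numInf) : ∑ i, ((vD D w i).map Prod.snd).sum = w.sum := by
  rw [← sum_take_drop (fun i => (infSigns (D.T i).clusters).length) w
    (hlen.trans (numInf_eq_sum D))]
  simp only [vD, map_snd_zip_eq_take, secOffset]

/-- The product `F_{λ⁽¹⁾}(v₁) ⋯ F_{λ⁽ᵏ⁾}(v_k)`. -/
noncomputable def prodF (D : SectionData t) (w : List ℝ) (ℓ : Fin D.k → BW) : ℝ :=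
  ∏ i, zigF (vD D w i) (ℓ i)

lemma phiTW_of_mem_Jt {a : BW} (ha : a ∈ Jt t) : phiTW t D w a = ⊤ := by
  rw [phiTW, if_neg (not_not.2 (Jt_subset_Zt ha)), if_pos ha]

lemma phiTW_assemble {ℓ : Fin D.k → BW} (hℓ : ∀ i, ℓ i ∈ Zt (D.T i))
    (haJ : assemble D ℓ ∉ Jt t) : phiTW t D w (assemble D ℓ) = ENNReal.ofReal (prodF D w ℓ) := by
  have h : ∃ ℓ' : Fin D.k → BW, decompOf D (assemble D ℓ) ℓ' := ⟨ℓ, hℓ, rfl⟩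
  rw [phiTW, if_neg (not_not.2 (assemble_mem_Zt hℓ)), if_neg haJ, dif_pos h]
  have h1 := h.choose_spec
  rw [← assemble_inj hℓ h1.1 haJ h1.2]
  simp only [prodF, Fword_eq_zigF]

lemma phiTW_ne_top {a : BW} (haZ : a ∈ Zt t) (haJ : a ∉ Jt t) : phiTW t D w a ≠ ⊤ := by
  obtain ⟨ℓ, hℓ, rfl⟩ := exists_decompOf (D := D) haZ haJ
  rw [phiTW_assemble hℓ haJ]
  exact ENNReal.ofReal_ne_top

lemma prodF_pos (hW : ∀ i, WeightedFinite (D.T i).clusters (vD D w i)) {ℓ : Fin D.k → BW}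
    (hℓ : ∀ i, ℓ i ∈ Zt (D.T i)) : 0 < prodF D w ℓ :=
  Finset.prod_pos fun i _ => ((hW i).zigF_pos_iff _).2.2 (hℓ i)

lemma prodF_nonneg (hW : ∀ i, WeightedFinite (D.T i).clusters (vD D w i)) (ℓ : Fin D.k → BW) :
    0 ≤ prodF D w ℓ :=
  Finset.prod_nonneg fun i _ => (hW i).zigF_nonneg _

lemma phiTW_pos (hW : ∀ i, WeightedFinite (D.T i).clusters (vD D w i)) {a : BW}
    (ha : a ∈ Zt t) : 0 < phiTW t D w a := by
  by_cases haJ : a ∈ Jt t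
  · rw [phiTW_of_mem_Jt haJ]
    exact ENNReal.coe_lt_top
  · obtain ⟨ℓ, hℓ, rfl⟩ := exists_decompOf (D := D) ha haJ
    rw [phiTW_assemble hℓ haJ]
    exact ENNReal.ofReal_pos.2 (prodF_pos hW hℓ)

lemma prodF_update (ℓ : Fin D.k → BW) (i : Fin D.k) (m : BW) :
    prodF D w (Function.update ℓ i m)
      = zigF (vD D w i) m * ∏ x ∈ Finset.univ.erase i, zigF (vD D w x) (ℓ x) := by
  rw [prodF, ← Finset.mul_prod_erase _ _ (Finset.mem_univ i), Function.update_self]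
  congr 1
  exact Finset.prod_congr rfl fun x hx => by rw [Function.update_of_ne (Finset.ne_of_mem_erase hx)]

lemma prodF_eq (ℓ : Fin D.k → BW) (i : Fin D.k) :
    prodF D w ℓ
      = zigF (vD D w i) (ℓ i) * ∏ x ∈ Finset.univ.erase i, zigF (vD D w x) (ℓ x) := by
  rw [← prodF_update, Function.update_eq_self]

lemma harmonicOn_phiTW (hW : ∀ i, WeightedFinite (D.T i).clusters (vD D w i))
    (hsum : ∑ i, ((vD D w i).map Prod.snd).sum = 1) : HarmonicOn (Zt t) (phiTW t D w) := by
  intro a ha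
  by_cases haJ : a ∈ Jt t
  · rw [phiTW_of_mem_Jt haJ]
    obtain ⟨b, hb, hab⟩ := exists_coveredBy_mem_Jt haJ
    symm
    rw [← top_le_iff, ← phiTW_of_mem_Jt (D := D) (w := w) hb]
    exact Finset.single_le_sum (fun _ _ => zero_le) (mem_upFinset.2 ⟨Jt_subset_Zt hb, hab⟩)
  · obtain ⟨ℓ, hℓ, rfl⟩ := exists_decompOf (D := D) ha haJ
    rw [sum_upFinset_assemble hℓ haJ, phiTW_assemble hℓ haJ]
    have h1 : ∀ i, ∑ m ∈ upFinset (Zt (D.T i)) (ℓ i),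
        phiTW t D w (assemble D (Function.update ℓ i m))
          = ENNReal.ofReal (((vD D w i).map Prod.snd).sum * prodF D w ℓ) := by
      intro i
      rw [prodF_eq ℓ i, ← mul_assoc, ← (hW i).sum_upFinset_zigF, Finset.sum_mul,
        ENNReal.ofReal_sum_of_nonneg fun m _ => mul_nonneg ((hW i).zigF_nonneg _)
          (Finset.prod_nonneg fun x _ => (hW x).zigF_nonneg _)]
      refine Finset.sum_congr rfl fun m hm => ?_
      have hm := mem_upFinset.1 hm
      rw [phiTW_assemble (update_mem_Zt hℓ hm.1)
        fun hJ => haJ (mem_Jt_of_sublist (coveredBy_assemble_update ℓ hm.2).1 hJ), prodF_update]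
    rw [Finset.sum_congr rfl fun i _ => h1 i, ← ENNReal.ofReal_sum_of_nonneg, ← Finset.sum_mul,
      hsum, one_mul]
    intro i _
    refine mul_nonneg ?_ (prodF_nonneg hW ℓ)
    rw [← zigF_nil]
    exact (hW i).zigF_nonneg _

lemma nil_mem_Jt (hsf : ¬t.IsFiniteTemplate) : [] ∈ Jt t := by
  simp only [Template.IsFiniteTemplate, not_forall] at hsf
  obtain ⟨p, hp, h1, h2⟩ := hsf
  exact ⟨p, ⟨hp, h1, h2⟩, nil_mem_Zcl _⟩

end SectionData

section KCone

variable {S : Set BW} {φ : BW → ℝ≥0∞} {f g : BW →₀ ℝ}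

lemma NonnegOn.zero : NonnegOn S 0 := ⟨fun _ => le_rfl, by simp⟩

lemma NonnegOn.add (hf : NonnegOn S f) (hg : NonnegOn S g) : NonnegOn S (f + g) := by
  refine ⟨fun x => add_nonneg (hf.1 x) (hg.1 x), fun x hx => ?_⟩
  rcases Finset.mem_union.1 (Finsupp.support_add hx) with h | h
  · exact hf.2 x h
  · exact hg.2 x h

lemma NonnegOn.smul (hf : NonnegOn S f) {r : ℝ} (hr : 0 ≤ r) : NonnegOn S (r • f) :=
  ⟨fun x => mul_nonneg hr (hf.1 x), fun x hx => hf.2 x (Finsupp.support_smul hx)⟩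

lemma NonnegOn.single {a : BW} (ha : a ∈ S) {r : ℝ} (hr : 0 ≤ r) :
    NonnegOn S (Finsupp.single a r) := by
  classical
  refine ⟨fun x => ?_, fun x hx => ?_⟩
  · rw [Finsupp.single_apply]
    split_ifs
    · exact hr
    · exact le_rfl
  · have := Finsupp.support_single_subset hx
    rw [Finset.mem_singleton] at this
    rwa [this]

lemma NonnegOn.sum {ι : Type*} {s : Finset ι} {F : ι → BW →₀ ℝ} (h : ∀ i ∈ s, NonnegOn S (F i)) :
    NonnegOn S (∑ i ∈ s, F i) :=
  Finset.sum_induction _ _ (fun _ _ => NonnegOn.add) .zero h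

lemma phiHat_eq_sum {s : Finset BW} (h : f.support ⊆ s) :
    phiHat φ f = ∑ x ∈ s, ENNReal.ofReal (f x) * φ x := by
  refine Finset.sum_subset h fun x _ hx => ?_
  rw [Finsupp.notMem_support_iff.1 hx, ENNReal.ofReal_zero, zero_mul]

lemma phiHat_zero : phiHat φ 0 = 0 := by simp [phiHat]

lemma phiHat_add (hf : NonnegOn S f) (hg : NonnegOn S g) :
    phiHat φ (f + g) = phiHat φ f + phiHat φ g := by
  rw [phiHat_eq_sum Finsupp.support_add, phiHat_eq_sum Finset.subset_union_left,
    phiHat_eq_sum (f := g) Finset.subset_union_right, ← Finset.sum_add_distrib]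
  refine Finset.sum_congr rfl fun x _ => ?_
  rw [Finsupp.add_apply, ENNReal.ofReal_add (hf.1 x) (hg.1 x), add_mul]

lemma phiHat_smul {r : ℝ} (hr : 0 ≤ r) : phiHat φ (r • f) = ENNReal.ofReal r * phiHat φ f := by
  rw [phiHat_eq_sum Finsupp.support_smul, phiHat, Finset.mul_sum]
  refine Finset.sum_congr rfl fun x _ => ?_
  rw [Finsupp.smul_apply, smul_eq_mul, ENNReal.ofReal_mul hr, mul_assoc]

lemma phiHat_single {a : BW} {r : ℝ} :
    phiHat φ (Finsupp.single a r) = ENNReal.ofReal r * φ a := by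
  rw [phiHat_eq_sum Finsupp.support_single_subset, Finset.sum_singleton, Finsupp.single_eq_same]

lemma phiHat_sum {ι : Type*} {s : Finset ι} {F : ι → BW →₀ ℝ}
    (h : ∀ i ∈ s, NonnegOn S (F i)) :
    phiHat φ (∑ i ∈ s, F i) = ∑ i ∈ s, phiHat φ (F i) := by
  classical
  induction s using Finset.induction_on with
  | empty => exact phiHat_zero
  | insert i s hi ih =>
    rw [Finset.forall_mem_insert] at h
    rw [Finset.sum_insert hi, Finset.sum_insert hi, phiHat_add h.1 (.sum h.2), ih h.2]

lemma sum_single_apply (f : BW →₀ ℝ) :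
    ∑ x ∈ f.support, f x • Finsupp.single x (1 : ℝ) = f := by
  conv_rhs => rw [← f.sum_single, Finsupp.sum]
  exact Finset.sum_congr rfl fun x _ => by rw [Finsupp.smul_single_one]

variable (S) in
open Classical in
/-- The map replacing every vertex of `S` in level `N` by the sum of its upper neighbours. -/
noncomputable def pushUp (N : ℕ) : (BW →₀ ℝ) →ₗ[ℝ] (BW →₀ ℝ) :=
  Finsupp.linearCombination ℝ fun a =>
    if a ∈ S ∧ a.length = N then ∑ b ∈ upFinset S a, Finsupp.single b (1 : ℝ)
    else Finsupp.single a 1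

lemma pushUp_single_of_eq {a : BW} (ha : a ∈ S) :
    pushUp S a.length (Finsupp.single a 1) = ∑ b ∈ upFinset S a, Finsupp.single b (1 : ℝ) := by
  simp [pushUp, ha]

lemma pushUp_single_of_ne {a : BW} {N : ℕ} (ha : a.length ≠ N) :
    pushUp S N (Finsupp.single a 1) = Finsupp.single a 1 := by
  simp [pushUp, ha]

lemma pushUp_single (hφ : HarmonicOn S φ) {a : BW} (ha : a ∈ S) (N : ℕ) :
    NonnegOn S (pushUp S N (Finsupp.single a 1)) ∧
      phiHat φ (pushUp S N (Finsupp.single a 1)) = φ a := by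
  by_cases h : a.length = N
  · subst h
    have h1 : ∀ b ∈ upFinset S a, NonnegOn S (Finsupp.single b (1 : ℝ)) := fun b hb =>
      .single (mem_upFinset.1 hb).1 zero_le_one
    rw [pushUp_single_of_eq ha, phiHat_sum h1, hφ a ha]
    refine ⟨.sum h1, Finset.sum_congr rfl fun b _ => ?_⟩
    rw [phiHat_single, ENNReal.ofReal_one, one_mul]
  · rw [pushUp_single_of_ne h, phiHat_single, ENNReal.ofReal_one, one_mul]
    exact ⟨.single ha zero_le_one, rfl⟩

lemma pushUp_nonnegOn (hφ : HarmonicOn S φ) (hf : NonnegOn S f) (N : ℕ) :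
    NonnegOn S (pushUp S N f) ∧ phiHat φ (pushUp S N f) = phiHat φ f := by
  have h1 : ∀ x ∈ f.support, NonnegOn S (f x • pushUp S N (Finsupp.single x 1)) := fun x hx =>
    (pushUp_single hφ (hf.2 x hx) N).1.smul (hf.1 x)
  rw [← sum_single_apply f, map_sum]
  simp only [map_smul]
  rw [sum_single_apply f]
  refine ⟨.sum h1, ?_⟩
  rw [phiHat_sum h1]
  refine Finset.sum_congr rfl fun x hx => ?_
  rw [phiHat_smul (hf.1 x), (pushUp_single hφ (hf.2 x hx) N).2]

variable (S) in
/-- The composition of `pushUp S 0, …, pushUp S (N - 1)`. -/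
noncomputable def pushTo : ℕ → (BW →₀ ℝ) →ₗ[ℝ] (BW →₀ ℝ)
  | 0 => LinearMap.id
  | N + 1 => pushUp S N ∘ₗ pushTo N

lemma pushTo_nonnegOn (hφ : HarmonicOn S φ) (hf : NonnegOn S f) (N : ℕ) :
    NonnegOn S (pushTo S N f) ∧ phiHat φ (pushTo S N f) = phiHat φ f := by
  induction N with
  | zero => exact ⟨hf, rfl⟩
  | succ N ih =>
    have := pushUp_nonnegOn hφ ih.1 N
    exact ⟨this.1, this.2.trans ih.2⟩

lemma pushUp_relOf {a : BW} (ha : a ∈ S) (N : ℕ) (hN : N ≤ a.length) :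
    pushUp S N (relOf S a) = if a.length = N then 0 else relOf S a := by
  have h1 : ∀ b ∈ upFinset S a, pushUp S N (Finsupp.single b 1) = Finsupp.single b 1 := by
    intro b hb
    have := (mem_upFinset.1 hb).2.2
    exact pushUp_single_of_ne (by omega)
  rw [relOf, map_sub, map_sum, Finset.sum_congr rfl h1]
  split_ifs with h
  · subst h
    rw [pushUp_single_of_eq ha, sub_self]
  · rw [pushUp_single_of_ne h]

lemma pushTo_relOf {a : BW} (ha : a ∈ S) (N : ℕ) :
    pushTo S N (relOf S a) = if a.length < N then 0 else relOf S a := by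
  induction N with
  | zero => rfl
  | succ N ih =>
    rw [pushTo, LinearMap.comp_apply, ih]
    by_cases h : a.length < N
    · rw [if_pos h, if_pos (by omega), map_zero]
    · rw [if_neg h, pushUp_relOf ha N (by omega)]
      congr 1
      rw [eq_iff_iff]
      omega

lemma exists_pushTo_eq_zero (hf : f ∈ Krel S) : ∃ N, ∀ n, N ≤ n → pushTo S n f = 0 := by
  refine Submodule.span_induction ?_ ⟨0, fun n _ => map_zero _⟩ ?_ ?_ hf
  · rintro _ ⟨a, ha, rfl⟩
    exact ⟨a.length + 1, fun n hn => by rw [pushTo_relOf ha, if_pos (by omega)]⟩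
  · rintro x y _ _ ⟨N, hN⟩ ⟨M, hM⟩
    refine ⟨max N M, fun n hn => ?_⟩
    rw [map_add, hN n (le_trans (le_max_left _ _) hn), hM n (le_trans (le_max_right _ _) hn),
      add_zero]
  · rintro r x _ ⟨N, hN⟩
    exact ⟨N, fun n hn => by rw [map_smul, hN n hn, smul_zero]⟩

lemma phiHat_congr (hφ : HarmonicOn S φ) (hf : NonnegOn S f) (hg : NonnegOn S g)
    (h : kmk S f = kmk S g) : phiHat φ f = phiHat φ g := by
  obtain ⟨N, hN⟩ := exists_pushTo_eq_zero ((Submodule.Quotient.eq _).1 h)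
  have h1 := hN N le_rfl
  rw [map_sub, sub_eq_zero] at h1
  rw [← (pushTo_nonnegOn hφ hf N).2, h1, (pushTo_nonnegOn hφ hg N).2]

lemma kmk_add : kmk S (f + g) = kmk S f + kmk S g := rfl

lemma kmk_sub : kmk S (f - g) = kmk S f - kmk S g := rfl

lemma phiHat_le_of_leK (hφ : HarmonicOn S φ) (hf : NonnegOn S f) (hg : NonnegOn S g)
    (h : leK S (kmk S g) (kmk S f)) : phiHat φ g ≤ phiHat φ f := by
  obtain ⟨d, hd, h⟩ := h
  rw [phiHat_congr hφ hf (hg.add hd) (by rw [kmk_add, h, add_sub_cancel]), phiHat_add hg hd]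
  exact le_self_add

lemma leK_of_nonnegOn (h : NonnegOn S (f - g)) : leK S (kmk S g) (kmk S f) :=
  ⟨f - g, h, kmk_sub⟩

lemma leK_refl : leK S (kmk S f) (kmk S f) := leK_of_nonnegOn (by rw [sub_self]; exact .zero)

lemma leK_trans {x y z : (BW →₀ ℝ) ⧸ Krel S} (h : leK S x y) (h' : leK S y z) : leK S x z := by
  obtain ⟨d, hd, h⟩ := h
  obtain ⟨d', hd', h'⟩ := h'
  exact ⟨d' + d, hd'.add hd, by rw [kmk_add, h, h']; abel⟩

lemma leK_add {x y x' y' : (BW →₀ ℝ) ⧸ Krel S} (h : leK S x y) (h' : leK S x' y') :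
    leK S (x + x') (y + y') := by
  obtain ⟨d, hd, h⟩ := h
  obtain ⟨d', hd', h'⟩ := h'
  exact ⟨d + d', hd.add hd', by rw [kmk_add, h, h']; abel⟩

lemma leK_sum {ι : Type*} {s : Finset ι} {F G : ι → BW →₀ ℝ}
    (h : ∀ i ∈ s, leK S (kmk S (F i)) (kmk S (G i))) :
    leK S (kmk S (∑ i ∈ s, F i)) (kmk S (∑ i ∈ s, G i)) := by
  classical
  induction s using Finset.induction_on with
  | empty => exact leK_refl
  | insert i s hi ih =>
    rw [Finset.forall_mem_insert] at h
    rw [Finset.sum_insert hi, Finset.sum_insert hi, kmk_add, kmk_add]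
    exact leK_add h.1 (ih h.2)

lemma leK_smul {r : ℝ} (hr : 0 ≤ r) (h : leK S (kmk S g) (kmk S f)) :
    leK S (kmk S (r • g)) (kmk S (r • f)) := by
  obtain ⟨d, hd, h⟩ := h
  refine ⟨r • d, hd.smul hr, ?_⟩
  change r • kmk S d = r • kmk S f - r • kmk S g
  rw [h, smul_sub]

lemma kmk_single {a : BW} (ha : a ∈ S) :
    kmk S (Finsupp.single a 1) = kmk S (∑ b ∈ upFinset S a, Finsupp.single b 1) :=
  (Submodule.Quotient.eq _).2 (Submodule.subset_span ⟨a, ha, rfl⟩)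

lemma leK_sum_single {a : BW} (ha : a ∈ S) {B : Finset BW} (hB : B ⊆ upFinset S a) :
    leK S (kmk S (∑ b ∈ B, Finsupp.single b 1)) (kmk S (Finsupp.single a 1)) := by
  classical
  rw [kmk_single ha, ← Finset.sum_sdiff hB]
  refine leK_of_nonnegOn ?_
  rw [add_sub_cancel_right]
  exact .sum fun b hb =>
    .single (mem_upFinset.1 (Finset.mem_sdiff.1 hb).1).1 zero_le_one

lemma leK_single_of_sublist (hS : ∀ a b : BW, a.Sublist b → b ∈ S → a ∈ S) {a b : BW}
    (hab : a.Sublist b) (hb : b ∈ S) :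
    leK S (kmk S (Finsupp.single b 1)) (kmk S (Finsupp.single a 1)) := by
  induction hn : b.length - a.length generalizing a with
  | zero =>
    rw [hab.eq_of_length (le_antisymm hab.length_le (by omega))]
    exact leK_refl
  | succ n ih =>
    obtain ⟨c, hac, hcb⟩ := exists_coveredBy_of_sublist hab (by omega)
    have h1 := leK_sum_single (S := S) (B := {c}) (hS a b hab hb)
      (by rw [Finset.singleton_subset_iff, mem_upFinset]; exact ⟨hS c b hcb hb, hac⟩)
    rw [Finset.sum_singleton] at h1
    exact leK_trans (ih hcb (by have := hac.2; omega)) h1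

lemma leK_smul_single_of_nonnegOn (hf : NonnegOn S f) {x : BW} (hx : x ∈ f.support) :
    leK S (kmk S (f x • Finsupp.single x 1)) (kmk S f) := by
  have h := Finset.sum_erase_eq_sub (f := fun x => f x • Finsupp.single x (1 : ℝ)) hx
  rw [sum_single_apply] at h
  refine leK_of_nonnegOn ?_
  rw [← h]
  exact .sum fun y hy =>
    (NonnegOn.single (hf.2 y (Finset.mem_of_mem_erase hy)) zero_le_one).smul (hf.1 y)

/-- A harmonic function is semifinite as soon as the vertices at which it is infinite dominate
elements of the cone with arbitrarily large finite values. -/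
lemma semifiniteOn_of_unbounded (hφ : HarmonicOn S φ) (hne : ∃ a ∈ S, φ a = ⊤)
    (h : ∀ a ∈ S, φ a = ⊤ → ∃ c : ℝ≥0∞, c ≠ 0 ∧ c ≠ ⊤ ∧ ∀ d : ℕ, ∃ g, NonnegOn S g ∧
      leK S (kmk S g) (kmk S (Finsupp.single a 1)) ∧ phiHat φ g = d * c) :
    SemifiniteOn S φ := by
  refine ⟨hne, fun f hf => le_antisymm ?_ (iSup₂_le fun g hg => phiHat_le_of_leK hφ hf hg.1 hg.2.1)⟩
  by_cases hfin : phiHat φ f = ⊤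
  · obtain ⟨a, ha, hfa⟩ := ENNReal.sum_eq_top.1 hfin
    have hfa0 : 0 < f a := lt_of_le_of_ne (hf.1 a) (Finsupp.mem_support_iff.1 ha).symm
    have hφa : φ a = ⊤ := by
      rcases ENNReal.mul_eq_top.1 hfa with h1 | h1
      · exact h1.2
      · exact absurd h1.1 ENNReal.ofReal_ne_top
    obtain ⟨c, hc0, hc, hd⟩ := h a (hf.2 a ha) hφa
    have hne : ENNReal.ofReal (f a) * c ≠ 0 := mul_ne_zero (ENNReal.ofReal_pos.2 hfa0).ne' hc0
    rw [hfin, top_le_iff]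
    refine ENNReal.eq_top_of_forall_nnreal_le fun r => ?_
    obtain ⟨d, hdr⟩ := ENNReal.exists_nat_mul_gt hne (ENNReal.coe_ne_top (r := r))
    obtain ⟨g, hg, hga, hgd⟩ := hd d
    have hval : phiHat φ (f a • g) = d * (ENNReal.ofReal (f a) * c) := by
      rw [phiHat_smul hfa0.le, hgd]
      ring
    refine hdr.le.trans ?_
    rw [← hval]
    refine le_iSup₂ (f := fun g _ => phiHat φ g) (f a • g) ⟨hg.smul hfa0.le,
      leK_trans (leK_smul hfa0.le hga) (leK_smul_single_of_nonnegOn hf ha), ?_⟩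
    rw [hval]
    exact ENNReal.mul_ne_top (ENNReal.natCast_ne_top d)
      (ENNReal.mul_ne_top ENNReal.ofReal_ne_top hc)
  · exact le_iSup₂ (f := fun g _ => phiHat φ g) f ⟨hf, leK_refl, hfin⟩

end KCone

lemma inst_decAt_add_single_injOn {cs : List (Bool × ℕ∞)}
    (hch : cs.IsChain fun c d => c.1 ≠ d.1) (hpos : ∀ c ∈ cs, c.2 ≠ 0) {n : ℕ → ℕ}
    (hn : ∀ i, 1 ≤ n i) {p : ℕ} (hp : p < cs.length) (hfin : (cs.getD p (true, 1)).2 ≠ ⊤)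
    (hsep : ¬(0 < p ∧ p + 1 < cs.length ∧ (cs.getD p (true, 1)).2 = 1 ∧
      (cs.getD (p - 1) (true, 1)).2 = ⊤ ∧ (cs.getD (p + 1) (true, 1)).2 = ⊤)) :
    Set.InjOn (fun j => inst (decAt cs p) (n + Pi.single j 1)) (infPos cs) := by
  have key : ∀ i j, i < j → i ∈ infPos cs → j ∈ infPos cs →
      inst (decAt cs p) (n + Pi.single i 1) ≠ inst (decAt cs p) (n + Pi.single j 1) := by
    intro i j hij hi hj h
    rw [mem_infPos] at hi hj
    have hjlt := getD_two_ne_top hj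
    have hip : i ≠ p := by rintro rfl; exact hfin hi
    have hjp : j ≠ p := by rintro rfl; exact hfin hj
    have hadd : ∀ j, (cs.getD j (true, 1)).2 = ⊤ → j ≠ p →
        inst (decAt cs p) (n + Pi.single j 1) = blockWord (cs.map Prod.fst)
          (Function.update (mults cs n) p (mults cs n p - 1) + Pi.single j 1) := by
      intro j hj hjp
      rw [inst_decAt hp hfin, mults_add_single hj]
      congr 1
      funext q
      by_cases hq : q = p
      · subst hq
        simp [Pi.single_eq_of_ne hjp.symm]
      · simp [hq]
    rw [hadd i hi hip, hadd j hj hjp] at h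
    obtain ⟨h1, h2⟩ := blockWord_add_single_inj hij (by simpa using hjlt) h
    have hne : ∀ q, q + 1 < cs.length →
        (cs.map Prod.fst).getD q true ≠ (cs.map Prod.fst).getD (q + 1) true := by
      intro q hq
      have := List.isChain_iff_getElem.1 (isChain_map_fst hch) q (by simpa using hq)
      rwa [List.getD_eq_getElem _ _ (by simp; omega), List.getD_eq_getElem _ _ (by simpa using hq)]
    have hm : ∀ q, q ≠ p → q < cs.length →
        0 < Function.update (mults cs n) p (mults cs n p - 1) q := by
      intro q hqp hq
      rw [Function.update_of_ne hqp]
      exact one_le_mults hpos hn hq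
    have hi1 : i + 1 ≠ j := by
      rintro rfl
      exact hne i hjlt h1.symm
    have hi1p : i + 1 = p := by
      by_contra hne'
      exact hne i (by omega) (h2 (i + 1) (by omega) (by omega) (hm _ hne' (by omega))).symm
    have hj1p : j = p + 1 := by
      by_contra hne'
      have h3 := h2 (j - 1) (by omega) (by omega) (hm _ (by omega) (by omega))
      have h4 := hne (j - 1) (by omega)
      rw [Nat.sub_add_cancel (by omega)] at h4
      exact h4 (h3.trans h1.symm)
    subst hi1p hj1p
    have hone : (cs.getD (i + 1) (true, 1)).2 = 1 := by
      have h3 : Function.update (mults cs n) (i + 1) (mults cs n (i + 1) - 1) (i + 1) = 0 := by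
        by_contra h0
        exact hne i hp (h2 (i + 1) (by omega) (by omega) (Nat.pos_of_ne_zero h0)).symm
      rw [Function.update_self] at h3
      have h4 := one_le_mults hpos hn hp
      have h5 : mults cs n (i + 1) = 1 := by omega
      rw [mults, if_neg hfin] at h5
      rw [← ENat.natCast_toNat hfin, h5]
      rfl
    exact hsep ⟨by omega, hjlt, hone, by simpa using hi, hj⟩
  intro i hi j hj h
  rcases lt_trichotomy i j with hlt | heq | hlt
  · exact absurd h (key i j hlt hi hj)
  · exact heq
  · exact absurd h.symm (key j i hlt hj hi)

section SectionData

variable {t : Template} {D : SectionData t} {w : List ℝ}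

lemma inst_notMem_Jt {n : ℕ → ℕ} (hn : ∀ i, 1 ≤ n i) : inst t.clusters n ∉ Jt t := by
  rintro ⟨p, hp, h⟩
  exact inst_notMem_decAt t.alternating t.pos hn hp.1 hp.2.1 h

lemma coveredBy_inst_decAt {n : ℕ → ℕ} (hn : ∀ i, 1 ≤ n i) {p : ℕ} (hp : IsFlangePos t p) :
    CoveredBy (inst (decAt t.clusters p) n) (inst t.clusters n) := by
  have h1 := one_le_mults t.pos hn hp.1
  rw [inst_decAt hp.1 hp.2.1]
  have hsub : ∀ i, Function.update (mults t.clusters n) p (mults t.clusters n p - 1) i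
      ≤ mults t.clusters n i := by
    intro i
    by_cases hip : i = p
    · subst hip; simp
    · rw [Function.update_of_ne hip]
  refine ⟨blockWord_sublist fun i _ => hsub i, ?_⟩
  rw [← inst_decAt hp.1 hp.2.1, length_inst, length_inst, mults_decAt hp.1 hp.2.1]
  have hmem : p ∈ Finset.range t.clusters.length := Finset.mem_range.2 hp.1
  have hlen : (decAt t.clusters p).length = t.clusters.length := by simp [decAt]
  rw [hlen, ← Finset.add_sum_erase _ (Function.update _ _ _) hmem,
    ← Finset.add_sum_erase _ (mults t.clusters n) hmem,
    Function.update_self, Finset.sum_congr rfl fun i hi =>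
      Function.update_of_ne (Finset.ne_of_mem_erase hi) _ _]
  omega

lemma infPos_subset_decAt {cs : List (Bool × ℕ∞)} {p : ℕ}
    (hfin : (cs.getD p (true, 1)).2 ≠ ⊤) : infPos cs ⊆ infPos (decAt cs p) := by
  intro j hj
  rw [mem_infPos] at hj ⊢
  have hjp : p ≠ j := by rintro rfl; exact hfin hj
  have h1 := getD_two_ne_top hj
  rw [decAt, List.getD_eq_getElem _ _ (by simpa using h1), List.getElem_set_ne hjp,
    ← List.getD_eq_getElem _ (true, 1)]
  exact hj

lemma one_le_add_single {n : ℕ → ℕ} (hn : ∀ i, 1 ≤ n i) (j i : ℕ) :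
    1 ≤ (n + Pi.single j 1 : ℕ → ℕ) i :=
  (hn i).trans (Nat.le_add_right _ _)

lemma HarmonicOn.inst_eq_sum {φ : BW → ℝ≥0∞} (hφ : HarmonicOn (Zt t) φ) {n : ℕ → ℕ}
    (hn : ∀ i, 1 ≤ n i) :
    φ (inst t.clusters n)
      = ∑ j ∈ infPos t.clusters, φ (inst t.clusters (n + Pi.single j 1)) := by
  rw [hφ _ (mem_Zcl_inst _ _), Zt, upFinset_inst t.alternating t.pos hn,
    Finset.sum_image (inst_add_single_injOn t.alternating t.pos hn)]

lemma inst_decAt_mem_Jt {p : ℕ} (hp : IsFlangePos t p) (n : ℕ → ℕ) :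
    inst (decAt t.clusters p) n ∈ Jt t := ⟨p, hp, mem_Zcl_inst _ _⟩

lemma leK_inst_decAt {n : ℕ → ℕ} (hn : ∀ i, 1 ≤ n i) {p : ℕ} (hp : IsFlangePos t p) :
    leK (Zt t) (kmk (Zt t) (Finsupp.single (inst t.clusters n) 1
        + ∑ j ∈ infPos t.clusters,
          Finsupp.single (inst (decAt t.clusters p) (n + Pi.single j 1)) 1))
      (kmk (Zt t) (Finsupp.single (inst (decAt t.clusters p) n) 1)) := by
  classical
  have hinj := inst_decAt_add_single_injOn t.alternating t.pos hn hp.1 hp.2.1 hp.2.2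
  have hnot : inst t.clusters n ∉ (infPos t.clusters).image fun j =>
      inst (decAt t.clusters p) (n + Pi.single j 1) := by
    intro h
    obtain ⟨j, -, h⟩ := Finset.mem_image.1 h
    refine inst_notMem_Jt (t := t) hn ?_
    rw [← h]
    exact inst_decAt_mem_Jt hp _
  rw [← Finset.sum_image (f := fun b => Finsupp.single b (1 : ℝ)) hinj,
    ← Finset.sum_insert (f := fun b => Finsupp.single b (1 : ℝ)) hnot]
  refine leK_sum_single (Jt_subset_Zt (inst_decAt_mem_Jt hp n)) ?_
  rw [Finset.insert_subset_iff, mem_upFinset]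
  refine ⟨⟨mem_Zcl_inst _ _, coveredBy_inst_decAt hn hp⟩, fun b hb => ?_⟩
  obtain ⟨j, hj, rfl⟩ := Finset.mem_image.1 hb
  exact mem_upFinset.2 ⟨Jt_subset_Zt (inst_decAt_mem_Jt hp _),
    coveredBy_inst_add_single _ _ (infPos_subset_decAt hp.2.1 hj)⟩

lemma exists_leK_inst_decAt {φ : BW → ℝ≥0∞} (hφ : HarmonicOn (Zt t) φ) {p : ℕ}
    (hp : IsFlangePos t p) (d : ℕ) {n : ℕ → ℕ} (hn : ∀ i, 1 ≤ n i) :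
    ∃ g, NonnegOn (Zt t) g ∧
      leK (Zt t) (kmk (Zt t) g) (kmk (Zt t) (Finsupp.single (inst (decAt t.clusters p) n) 1)) ∧
      phiHat φ g = d * φ (inst t.clusters n) := by
  induction d generalizing n with
  | zero =>
    refine ⟨0, .zero, leK_of_nonnegOn ?_, by simp [phiHat_zero]⟩
    rw [sub_zero]
    exact .single (Jt_subset_Zt (inst_decAt_mem_Jt hp n)) zero_le_one
  | succ d ih =>
    choose G hG hle hval using fun j => ih (one_le_add_single hn j)
    have hy : NonnegOn (Zt t) (Finsupp.single (inst t.clusters n) 1) :=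
      .single (mem_Zcl_inst _ _) zero_le_one
    refine ⟨Finsupp.single (inst t.clusters n) 1 + ∑ j ∈ infPos t.clusters, G j,
      hy.add (.sum fun j _ => hG j), leK_trans ?_ (leK_inst_decAt hn hp), ?_⟩
    · rw [kmk_add, kmk_add]
      exact leK_add leK_refl (leK_sum fun j _ => hle j)
    · rw [phiHat_add hy (.sum fun j _ => hG j), phiHat_sum fun j _ => hG j, phiHat_single,
        Finset.sum_congr rfl fun j _ => hval j, ← Finset.mul_sum, ← hφ.inst_eq_sum hn]
      push_cast
      rw [ENNReal.ofReal_one]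
      ring

lemma semifiniteOn_phiTW (hsf : ¬t.IsFiniteTemplate)
    (hW : ∀ i, WeightedFinite (D.T i).clusters (vD D w i))
    (hφ : HarmonicOn (Zt t) (phiTW t D w)) : SemifiniteOn (Zt t) (phiTW t D w) := by
  refine semifiniteOn_of_unbounded hφ ⟨[], nil_mem_Zcl _, phiTW_of_mem_Jt (nil_mem_Jt hsf)⟩ ?_
  intro a ha htop
  have haJ : a ∈ Jt t := by
    by_contra haJ
    exact phiTW_ne_top ha haJ htop
  obtain ⟨p, hp, N, hN⟩ := haJ
  have h1 : ∀ i, 1 ≤ (fun _ : ℕ => N + 1) i := fun i => Nat.le_add_left _ _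
  refine ⟨phiTW t D w (inst t.clusters fun _ => N + 1), (phiTW_pos hW (mem_Zcl_inst _ _)).ne',
    phiTW_ne_top (mem_Zcl_inst _ _) (inst_notMem_Jt h1), fun d => ?_⟩
  obtain ⟨g, hg, hle, hval⟩ := exists_leK_inst_decAt hφ hp d h1
  refine ⟨g, hg, leK_trans hle ?_, hval⟩
  refine leK_single_of_sublist (fun _ _ => mem_Zcl_of_sublist) ?_
    (Jt_subset_Zt (inst_decAt_mem_Jt hp _))
  rw [clWord_eq_inst] at hN
  exact hN.trans (inst_sublist fun _ => Nat.le_add_right _ _)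

end SectionData

lemma eq_iterate_add_single {j : ℕ} {h : (ℕ → ℕ) → ℝ} (n : ℕ → ℕ) (K : ℕ) :
    h (n + Pi.single j K) - h n
      = ∑ k ∈ Finset.range K, (h (n + Pi.single j k + Pi.single j 1) - h (n + Pi.single j k)) := by
  have h1 := Finset.sum_range_sub (fun k => h (n + Pi.single j k)) K
  simp only [Pi.single_zero, add_zero] at h1
  rw [← h1]
  refine Finset.sum_congr rfl fun k _ => ?_
  rw [add_assoc, ← Pi.single_add]

/-- Bounded functions on `ℕ^P` which are harmonic for a positive convolution kernel do not
increase along the coordinate directions. -/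
lemma add_single_le_of_harmonic {P : Finset ℕ} {ω : ℕ → ℝ} (hω : ∀ j ∈ P, 0 < ω j)
    (hsum : ∑ j ∈ P, ω j = 1) {h : (ℕ → ℕ) → ℝ} {C : ℝ} (hC : ∀ n, |h n| ≤ C)
    (hh : ∀ n, h n = ∑ j ∈ P, ω j * h (n + Pi.single j 1)) {j : ℕ} (hj : j ∈ P) (n : ℕ → ℕ) :
    h (n + Pi.single j 1) ≤ h n := by
  set d : (ℕ → ℕ) → ℝ := fun n => h (n + Pi.single j 1) - h n with hd
  have hbdd : BddAbove (Set.range d) := by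
    refine ⟨2 * C, ?_⟩
    rintro _ ⟨n, rfl⟩
    have h1 := abs_le.1 (hC (n + Pi.single j 1))
    have h2 := abs_le.1 (hC n)
    simp only [hd]
    linarith
  have hharm : ∀ n, d n = ∑ i ∈ P, ω i * d (n + Pi.single i 1) := by
    intro n
    simp only [hd, mul_sub, Finset.sum_sub_distrib]
    rw [hh (n + Pi.single j 1), hh n]
    simp only [add_right_comm]
  set s := ⨆ n, d n with hs
  have hle : ∀ n, d n ≤ s := fun n => le_ciSup hbdd n
  by_contra! hlt
  have hspos : 0 < s := lt_of_lt_of_le (sub_pos.2 hlt) (hle n)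
  have hωj := hω j hj
  have hωj1 : ω j ≤ 1 := by
    rw [← hsum]
    exact Finset.single_le_sum (f := ω) (fun i hi => (hω i hi).le) hj
  have hstep : ∀ n ε, s - ω j * ε ≤ d n → s - ε ≤ d (n + Pi.single j 1) := by
    intro n ε hn
    have h1 : ∑ i ∈ P.erase j, ω i * d (n + Pi.single i 1) ≤ (1 - ω j) * s := by
      rw [← hsum, ← Finset.add_sum_erase P ω hj, add_sub_cancel_left, Finset.sum_mul]
      exact Finset.sum_le_sum fun i hi =>
        mul_le_mul_of_nonneg_left (hle _) (hω i (Finset.mem_of_mem_erase hi)).le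
    have h2 := hharm n
    rw [← Finset.add_sum_erase _ _ hj] at h2
    have h3 : ω j * (s - ε) ≤ ω j * d (n + Pi.single j 1) := by nlinarith
    exact le_of_mul_le_mul_left h3 hωj
  have hiter : ∀ (k : ℕ) n ε, s - ω j ^ k * ε ≤ d n → s - ε ≤ d (n + Pi.single j k) := by
    intro k
    induction k with
    | zero =>
      intro n ε hn
      simpa using hn
    | succ k ih =>
      intro n ε hn
      rw [Pi.single_add, ← add_assoc]
      exact hstep _ _ (ih n _ (by rw [← mul_assoc, ← pow_succ]; exact hn))
  obtain ⟨K, hK⟩ := exists_nat_gt (2 * C / (s / 2))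
  rw [div_lt_iff₀ (by positivity)] at hK
  obtain ⟨n₀, hn₀⟩ := exists_lt_of_lt_ciSup
    (show s - ω j ^ K * (s / 2) < ⨆ n, d n from sub_lt_self _ (by positivity))
  have hlow : ∀ k ∈ Finset.range K, s / 2 ≤ d (n₀ + Pi.single j k) := by
    intro k hk
    have h1 := hiter k n₀ (s / 2) (le_trans (sub_le_sub_left (mul_le_mul_of_nonneg_right
      (pow_le_pow_of_le_one hωj.le hωj1 (Finset.mem_range.1 hk).le) (by positivity)) _) hn₀.le)
    linarith
  have h1 := Finset.sum_le_sum hlow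
  rw [Finset.sum_const, Finset.card_range, nsmul_eq_mul, ← eq_iterate_add_single] at h1
  have h2 := abs_le.1 (hC (n₀ + Pi.single j K))
  have h3 := abs_le.1 (hC n₀)
  linarith

lemma add_single_eq_of_harmonic {P : Finset ℕ} {ω : ℕ → ℝ} (hω : ∀ j ∈ P, 0 < ω j)
    (hsum : ∑ j ∈ P, ω j = 1) {h : (ℕ → ℕ) → ℝ} {C : ℝ} (hC : ∀ n, |h n| ≤ C)
    (hh : ∀ n, h n = ∑ j ∈ P, ω j * h (n + Pi.single j 1)) {j : ℕ} (hj : j ∈ P) (n : ℕ → ℕ) :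
    h (n + Pi.single j 1) = h n := by
  refine le_antisymm (add_single_le_of_harmonic hω hsum hC hh hj n) ?_
  refine neg_le_neg_iff.1 (add_single_le_of_harmonic (h := fun n => -h n) hω hsum (C := C)
    (fun n => by rw [abs_neg]; exact hC n) (fun n => ?_) hj n)
  rw [hh n, ← Finset.sum_neg_distrib]
  exact Finset.sum_congr rfl fun i _ => by ring

section Real

variable {S V : Set BW} {f h : BW → ℝ}

lemma sum_le_of_harmonic (hS : ∀ a b : BW, a.Sublist b → b ∈ S → a ∈ S)
    (hV : ∀ a ∈ V, ∀ b ∈ S, a.Sublist b → b ∈ V) (hf : ∀ a ∈ V, f a = ∑ b ∈ upFinset S a, f b)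
    (hf0 : ∀ a ∈ V, 0 ≤ f a) {L : ℕ} {a : BW} (ha : a ∈ V) {B : Finset BW}
    (hB : ∀ b ∈ B, b ∈ S ∧ a.Sublist b ∧ b.length = a.length + L) : ∑ b ∈ B, f b ≤ f a := by
  induction L generalizing a B with
  | zero =>
    have h1 : B ⊆ {a} := fun b hb => by
      rw [Finset.mem_singleton]
      exact ((hB b hb).2.1.eq_of_length (hB b hb).2.2.symm).symm
    refine (Finset.sum_le_sum_of_subset_of_nonneg h1 fun b hb _ => ?_).trans
      (Finset.sum_singleton f a).le
    rw [Finset.mem_singleton] at hb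
    rw [hb]
    exact hf0 a ha
  | succ L ih =>
    have h1 : ∀ b, ∃ c, b ∈ B → c ∈ upFinset S a ∧ c.Sublist b := by
      intro b
      by_cases hb : b ∈ B
      · obtain ⟨h1, h2, h3⟩ := hB b hb
        obtain ⟨c, hac, hcb⟩ := exists_coveredBy_of_sublist h2 (by omega)
        exact ⟨c, fun _ => ⟨mem_upFinset.2 ⟨hS c b hcb h1, hac⟩, hcb⟩⟩
      · exact ⟨b, fun h => absurd h hb⟩
    choose g hg using h1
    rw [hf a ha, ← Finset.sum_fiberwise_of_maps_to fun b hb => (hg b hb).1]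
    refine Finset.sum_le_sum fun c hc => ?_
    have hc := mem_upFinset.1 hc
    refine ih (hV a ha c hc.1 hc.2.1) fun b hb => ?_
    obtain ⟨hbB, rfl⟩ := Finset.mem_filter.1 hb
    refine ⟨(hB b hbB).1, (hg b hbB).2, ?_⟩
    rw [(hB b hbB).2.2, hc.2.2]
    omega

lemma eq_zero_of_spreads (hS : ∀ a b : BW, a.Sublist b → b ∈ S → a ∈ S)
    (hV : ∀ a ∈ V, ∀ b ∈ S, a.Sublist b → b ∈ V) (hf : ∀ a ∈ V, f a = ∑ b ∈ upFinset S a, f b)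
    (hf0 : ∀ a ∈ V, 0 < f a) (hh : ∀ a ∈ V, h a = ∑ b ∈ upFinset S a, h b) {C : ℝ}
    (hC : ∀ a ∈ V, |h a| ≤ C * f a) {G : Set BW} (hG : G ⊆ S) (hhG : ∀ a ∈ G, h a = 0)
    {L : ℕ} {δ : ℝ} (hδ : 0 < δ) (hsp : ∀ a ∈ V, Spreads G f L δ a) {a : BW} (ha : a ∈ V) :
    h a = 0 := by
  have hstep : ∀ ε, ∀ g : BW → ℝ, 0 ≤ ε → (∀ a ∈ V, g a = ∑ b ∈ upFinset S a, g b) →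
      (∀ a ∈ G, g a = 0) → (∀ a ∈ V, g a ≤ ε * f a) → ∀ a ∈ V, g a ≤ ε * (1 - δ) * f a := by
    intro ε g hε hg hgG hle a ha
    obtain ⟨B, hB, hBδ⟩ := hsp a ha
    have h1 := sum_le_of_harmonic (f := fun a => ε * f a - g a) (L := L) (B := B) hS hV
      (fun a ha => by
        rw [Finset.sum_sub_distrib, ← Finset.mul_sum, ← hf a ha, ← hg a ha])
      (fun a ha => sub_nonneg.2 (hle a ha)) ha
      fun b hb => ⟨hG (hB b hb).2.2, (hB b hb).1, (hB b hb).2.1⟩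
    rw [Finset.sum_sub_distrib, ← Finset.mul_sum,
      Finset.sum_eq_zero fun b hb => hgG b (hB b hb).2.2] at h1
    have h2 := mul_le_mul_of_nonneg_left hBδ hε
    linarith
  have hδ1 : δ ≤ 1 := by
    obtain ⟨B, hB, hBδ⟩ := hsp a ha
    have h1 := hBδ.trans (sum_le_of_harmonic (L := L) hS hV hf (fun a ha => (hf0 a ha).le) ha
      fun b hb => ⟨hG (hB b hb).2.2, (hB b hb).1, (hB b hb).2.1⟩)
    exact le_of_mul_le_mul_right (by linarith) (hf0 a ha)
  have hC0 : 0 ≤ C := nonneg_of_mul_nonneg_left ((abs_nonneg _).trans (hC a ha)) (hf0 a ha)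
  have hN : ∀ N : ℕ, ∀ a ∈ V, |h a| ≤ C * (1 - δ) ^ N * f a := by
    intro N
    induction N with
    | zero => simpa using hC
    | succ N ih =>
      intro a ha
      have hε : 0 ≤ C * (1 - δ) ^ N := mul_nonneg hC0 (pow_nonneg (by linarith) _)
      rw [pow_succ, ← mul_assoc, abs_le']
      refine ⟨hstep _ h hε hh hhG (fun a ha => (le_abs_self _).trans (ih a ha)) a ha,
        hstep _ (fun a => -h a) hε (fun a ha => by rw [hh a ha, Finset.sum_neg_distrib])
          (fun a ha => by rw [hhG a ha, neg_zero])
          (fun a ha => (neg_le_abs _).trans (ih a ha)) a ha⟩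
  have hlim : Filter.Tendsto (fun N : ℕ => C * (1 - δ) ^ N * f a) Filter.atTop (nhds 0) := by
    have := ((tendsto_pow_atTop_nhds_zero_of_lt_one (by linarith : 0 ≤ 1 - δ)
      (by linarith)).const_mul C).mul_const (f a)
    simpa using this
  exact abs_nonpos_iff.1 (ge_of_tendsto' hlim fun N => hN N a ha)

end Real

section SectionData

variable {t : Template} {D : SectionData t} {w : List ℝ}

lemma notMem_Jt_of_generic {a : BW} (ha : a ∈ Generic t.clusters) : a ∉ Jt t := by
  obtain ⟨n, hn, rfl⟩ := ha
  exact inst_notMem_Jt fun i => one_le_two.trans (hn i)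

lemma generic_subset_Zcl (cs : List (Bool × ℕ∞)) : Generic cs ⊆ Zcl cs := by
  rintro a ⟨n, -, rfl⟩
  exact mem_Zcl_inst _ _

lemma toReal_phiTW_assemble (hW : ∀ i, WeightedFinite (D.T i).clusters (vD D w i))
    {ℓ : Fin D.k → BW} (hℓ : ∀ i, ℓ i ∈ Zt (D.T i)) (haJ : assemble D ℓ ∉ Jt t) :
    (phiTW t D w (assemble D ℓ)).toReal = prodF D w ℓ := by
  rw [phiTW_assemble hℓ haJ, ENNReal.toReal_ofReal (prodF_nonneg hW ℓ)]

lemma generic_assemble {ℓ : Fin D.k → BW} (hℓ : ∀ i, ℓ i ∈ Generic (D.T i).clusters) :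
    assemble D ℓ ∈ Generic t.clusters := by
  rw [assemble_eq_asm, clusters_eq_asm D]
  exact generic_asm (fun j => generic_flangeWord (D.finA j)) hℓ

lemma exists_spreads_phiTW (hW : ∀ i, WeightedFinite (D.T i).clusters (vD D w i)) :
    ∃ (L : ℕ) (δ : ℝ), 0 < δ ∧ ∀ a ∈ Zt t, a ∉ Jt t →
      Spreads (Generic t.clusters) (fun a => (phiTW t D w a).toReal) L δ a := by
  classical
  choose L δ hδ _ hsp using fun i => (hW i).exists_spreads
  refine ⟨∑ i, L i, ∏ i, δ i, Finset.prod_pos fun i _ => hδ i, fun a haZ haJ => ?_⟩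
  obtain ⟨ℓ, hℓ, rfl⟩ := exists_decompOf (D := D) haZ haJ
  choose B hB hBδ using fun i => hsp i (ℓ i)
  have hmem : ∀ {m}, m ∈ Fintype.piFinset B → ∀ i, m i ∈ Generic (D.T i).clusters :=
    fun hm i => (hB i _ (Fintype.mem_piFinset.1 hm i)).2.2
  have hmemZ : ∀ {m}, m ∈ Fintype.piFinset B → ∀ i, m i ∈ Zt (D.T i) :=
    fun hm i => generic_subset_Zcl _ (hmem hm i)
  refine ⟨(Fintype.piFinset B).image (assemble D), fun b hb => ?_, ?_⟩
  · obtain ⟨m, hm, rfl⟩ := Finset.mem_image.1 hb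
    have hm' := Fintype.mem_piFinset.1 hm
    refine ⟨assemble_sublist fun i => (hB i _ (hm' i)).1, ?_, generic_assemble (hmem hm)⟩
    rw [length_assemble, length_assemble, add_assoc, ← Finset.sum_add_distrib]
    exact congrArg _ (Finset.sum_congr rfl fun i _ => (hB i _ (hm' i)).2.1)
  · change _ * (phiTW t D w _).toReal ≤ ∑ b ∈ _, (phiTW t D w b).toReal
    rw [Finset.sum_image fun m hm m' hm' h => assemble_inj (hmemZ hm) (hmemZ hm')
      (notMem_Jt_of_generic (generic_assemble (hmem hm))) h,
      Finset.sum_congr rfl fun m hm => toReal_phiTW_assemble hW (hmemZ hm)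
        (notMem_Jt_of_generic (generic_assemble (hmem hm))),
      toReal_phiTW_assemble hW hℓ haJ]
    simp only [prodF]
    rw [← Finset.prod_univ_sum B fun i m => zigF (vD D w i) m, ← Finset.prod_mul_distrib]
    exact Finset.prod_le_prod (fun i _ => mul_nonneg (hδ i).le ((hW i).zigF_nonneg _))
      fun i _ => hBδ i

lemma exists_scaling_phiTW (hW : ∀ i, WeightedFinite (D.T i).clusters (vD D w i)) {j : ℕ}
    (hj : j ∈ infPos t.clusters) : ∃ ω : ℝ, 0 < ω ∧ ∀ n, (∀ i, 2 ≤ n i) →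
      (phiTW t D w (inst t.clusters (n + Pi.single j 1))).toReal
        = ω * (phiTW t D w (inst t.clusters n)).toReal := by
  obtain ⟨o, ho, hinf, hdisj⟩ := exists_offsets (C := fun i => (D.T i).clusters) D.finA
  rw [← clusters_eq_asm D] at ho hinf
  obtain ⟨i, q, rfl, hq⟩ := hinf j (mem_infPos.1 hj)
  obtain ⟨ω, hω, hscale⟩ := (hW i).exists_scaling q hq
  refine ⟨ω, hω, fun n hn => ?_⟩
  have hval : ∀ n : ℕ → ℕ, (∀ i, 2 ≤ n i) → (phiTW t D w (inst t.clusters n)).toReal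
      = prodF D w fun i => inst (D.T i).clusters fun q => n (q + o i) := by
    intro n hn
    have h1 : inst t.clusters n
        = assemble D fun i => inst (D.T i).clusters fun q => n (q + o i) := by
      rw [ho, assemble_eq_asm]
    rw [h1]
    refine toReal_phiTW_assemble hW (fun i => mem_Zcl_inst _ _) ?_
    rw [← h1]
    exact inst_notMem_Jt fun i => one_le_two.trans (hn i)
  have hupd : (fun i' => inst (D.T i').clusters
      fun q' => (n + Pi.single (q + o i) 1 : ℕ → ℕ) (q' + o i'))
      = Function.update (fun i' => inst (D.T i').clusters fun q' => n (q' + o i')) i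
        (inst (D.T i).clusters ((fun q' => n (q' + o i)) + Pi.single q 1)) := by
    funext i'
    by_cases h : i' = i
    · subst h
      rw [Function.update_self]
      refine inst_congr fun q' _ _ => ?_
      simp [Pi.single_apply]
    · rw [Function.update_of_ne h]
      refine inst_congr fun q' hq' _ => ?_
      rw [Pi.add_apply, Pi.single_eq_of_ne, add_zero]
      exact fun heq => h (hdisj i' i q' q hq' (getD_two_ne_top hq) heq)
  rw [hval (n + Pi.single (q + o i) 1) fun i => (hn i).trans (Nat.le_add_right _ _), hval n hn,
    hupd, prodF_update,
    hscale (fun q' => n (q' + o i)) (one_le_two.trans (hn _)) (fun q => hn _), mul_assoc,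
    ← prodF_eq (w := w) (fun i' => inst (D.T i').clusters fun q' => n (q' + o i')) i]

lemma toReal_eq_sum {φ : BW → ℝ≥0∞} (hφ : HarmonicOn (Zt t) φ) {a : BW}
    (ha : a ∈ Zt t) (hfin : φ a ≠ ⊤) :
    (φ a).toReal = ∑ b ∈ upFinset (Zt t) a, (φ b).toReal := by
  rw [hφ a ha] at hfin ⊢
  exact ENNReal.toReal_sum fun b hb => fun h => hfin (ENNReal.sum_eq_top.2 ⟨b, hb, h⟩)

lemma eq_of_add_single_eq {cs : List (Bool × ℕ∞)} {F : BW → ℝ}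
    (hF : ∀ j ∈ infPos cs, ∀ n : ℕ → ℕ, F (inst cs ((n + Pi.single j 1) + fun _ => 2))
      = F (inst cs (n + fun _ => 2))) (n : ℕ → ℕ) :
    F (inst cs (n + fun _ => 2)) = F (inst cs fun _ => 2) := by
  induction hN : ∑ j ∈ infPos cs, n j generalizing n with
  | zero =>
    congr 1
    refine inst_congr fun i _ hi => ?_
    simp [Finset.sum_eq_zero_iff.1 hN i (mem_infPos.2 hi)]
  | succ N ih =>
    obtain ⟨j, hj, hnj⟩ := Finset.exists_ne_zero_of_sum_ne_zero (by rw [hN]; omega :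
      ∑ j ∈ infPos cs, n j ≠ 0)
    have h1 : n = Function.update n j (n j - 1) + Pi.single j 1 := by
      funext i
      by_cases h : i = j
      · subst h
        simp only [Pi.add_apply, Function.update_self, Pi.single_eq_same]
        omega
      · simp [h]
    rw [h1, hF j hj]
    refine ih _ ?_
    rw [h1, Finset.sum_congr rfl fun i _ => Pi.add_apply _ _ i, Finset.sum_add_distrib,
      Finset.sum_pi_single' j 1] at hN
    simp only [hj, if_true] at hN
    omega

lemma indecSemifiniteOn_phiTW (hW : ∀ i, WeightedFinite (D.T i).clusters (vD D w i))
    (hφ : HarmonicOn (Zt t) (phiTW t D w)) : IndecSemifiniteOn (Zt t) (phiTW t D w) := by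
  intro φ' hφ' _ hle _
  set f : BW → ℝ := fun a => (phiTW t D w a).toReal with hf
  set ψ : BW → ℝ := fun a => (φ' a).toReal with hψ
  have hfpos : ∀ a ∈ Zt t, a ∉ Jt t → 0 < f a := fun a ha haJ =>
    ENNReal.toReal_pos (phiTW_pos hW ha).ne' (phiTW_ne_top ha haJ)
  have hψle : ∀ a ∈ Zt t, a ∉ Jt t → ψ a ≤ f a := fun a ha haJ =>
    ENNReal.toReal_mono (phiTW_ne_top ha haJ) (hle a ha)
  have hψ0 : ∀ a, 0 ≤ ψ a := fun a => ENNReal.toReal_nonneg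
  have hφ'fin : ∀ a ∈ Zt t, a ∉ Jt t → φ' a ≠ ⊤ := fun a ha haJ =>
    ne_top_of_le_ne_top (phiTW_ne_top ha haJ) (hle a ha)
  have hgen : ∀ n : ℕ → ℕ, inst t.clusters (n + fun _ => 2) ∈ Generic t.clusters := fun n =>
    ⟨_, fun i => Nat.le_add_left _ _, rfl⟩
  have hgenZ : ∀ n : ℕ → ℕ, inst t.clusters (n + fun _ => 2) ∈ Zt t := fun n => mem_Zcl_inst _ _
  have hinst : ∀ φ : BW → ℝ≥0∞, HarmonicOn (Zt t) φ →
      (∀ a ∈ Zt t, a ∉ Jt t → φ a ≠ ⊤) → ∀ n : ℕ → ℕ,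
      (φ (inst t.clusters (n + fun _ => 2))).toReal = ∑ j ∈ infPos t.clusters,
        (φ (inst t.clusters ((n + Pi.single j 1) + fun _ => 2))).toReal := by
    intro φ hφ hfin n
    have h1 := hfin _ (hgenZ n) (notMem_Jt_of_generic (hgen n))
    have h2 := hφ.inst_eq_sum (n := n + fun _ => 2) fun i => Nat.le_add_left_of_le one_le_two
    rw [h2] at h1 ⊢
    rw [ENNReal.toReal_sum fun b hb => fun h => h1 (ENNReal.sum_eq_top.2 ⟨b, hb, h⟩)]
    simp only [add_right_comm]
  have hω : ∀ j, ∃ ω : ℝ, j ∈ infPos t.clusters → 0 < ω ∧ ∀ n : ℕ → ℕ,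
      f (inst t.clusters ((n + Pi.single j 1) + fun _ => 2))
        = ω * f (inst t.clusters (n + fun _ => 2)) := by
    intro j
    by_cases hj : j ∈ infPos t.clusters
    · obtain ⟨ω, hω, h⟩ := exists_scaling_phiTW hW hj
      refine ⟨ω, fun _ => ⟨hω, fun n => ?_⟩⟩
      rw [add_right_comm]
      exact h _ fun i => Nat.le_add_left _ _
    · exact ⟨0, fun h => absurd h hj⟩
  choose ω hω using hω
  have hfg : ∀ n : ℕ → ℕ, 0 < f (inst t.clusters (n + fun _ => 2)) := fun n =>
    hfpos _ (hgenZ n) (notMem_Jt_of_generic (hgen n))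
  have hωsum : ∑ j ∈ infPos t.clusters, ω j = 1 := by
    have h1 := hinst _ hφ (fun a => phiTW_ne_top) 0
    change f _ = ∑ j ∈ _, f _ at h1
    rw [Finset.sum_congr rfl fun j hj => (hω j hj).2 0, ← Finset.sum_mul] at h1
    exact (mul_right_cancel₀ (hfg 0).ne' (by rw [one_mul]; exact h1)).symm
  have hconst := eq_of_add_single_eq (cs := t.clusters) (F := fun a => ψ a / f a)
    fun j hj n => add_single_eq_of_harmonic (h := fun n => ψ (inst t.clusters (n + fun _ => 2))
      / f (inst t.clusters (n + fun _ => 2))) (C := 1) (fun j hj => (hω j hj).1) hωsum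
      (fun n => by
        rw [abs_of_nonneg (div_nonneg (hψ0 _) (hfg n).le), div_le_one (hfg n)]
        exact hψle _ (hgenZ n) (notMem_Jt_of_generic (hgen n)))
      (fun n => by
        have h1 : ψ _ = ∑ j ∈ _, ψ _ := hinst _ hφ' hφ'fin n
        rw [h1, Finset.sum_div]
        refine Finset.sum_congr rfl fun j hj => ?_
        have h2 := (hω j hj).1.ne'
        have h3 := (hfg n).ne'
        rw [(hω j hj).2 n]
        field_simp) hj n
  set c : ℝ := ψ (inst t.clusters fun _ => 2) / f (inst t.clusters fun _ => 2) with hc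
  have hc0 : 0 ≤ c := div_nonneg (hψ0 _) ENNReal.toReal_nonneg
  obtain ⟨L, δ, hδ, hsp⟩ := exists_spreads_phiTW hW
  have key : ∀ a ∈ Zt t, a ∉ Jt t → ψ a - c * f a = 0 := by
    intro a ha haJ
    refine eq_zero_of_spreads (S := Zt t) (V := {a | a ∈ Zt t ∧ a ∉ Jt t}) (f := f)
      (h := fun a => ψ a - c * f a) (C := 1 + c) (G := Generic t.clusters)
      (fun _ _ => mem_Zcl_of_sublist)
      (fun a ha b hb hab => ⟨hb, fun hbJ => ha.2 (mem_Jt_of_sublist hab hbJ)⟩)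
      (fun a ha => toReal_eq_sum hφ ha.1 (phiTW_ne_top ha.1 ha.2))
      (fun a ha => hfpos a ha.1 ha.2) (fun a ha => ?_) (fun a ha => ?_)
      (generic_subset_Zcl _) (fun a ha => ?_) hδ (fun a ha => hsp a ha.1 ha.2) ⟨ha, haJ⟩
    · rw [Finset.sum_sub_distrib, ← Finset.mul_sum]
      have h1 : f a = _ := toReal_eq_sum hφ ha.1 (phiTW_ne_top ha.1 ha.2)
      have h2 : ψ a = _ := toReal_eq_sum hφ' ha.1 (hφ'fin a ha.1 ha.2)
      rw [h1, h2]
    · have h1 := hψ0 a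
      have h2 := hψle a ha.1 ha.2
      have h3 := mul_nonneg hc0 (hfpos a ha.1 ha.2).le
      rw [abs_le]
      constructor <;> linarith
    · obtain ⟨n, hn, rfl⟩ := ha
      obtain ⟨k, rfl⟩ : ∃ k : ℕ → ℕ, n = k + fun _ => 2 :=
        ⟨fun i => n i - 2, funext fun i => (Nat.sub_add_cancel (hn i)).symm⟩
      rw [sub_eq_zero, ← div_eq_iff (hfg k).ne']
      exact hconst k
  refine ⟨c.toNNReal, fun a ha hfin => ?_⟩
  have haJ : a ∉ Jt t := fun h => hfin (phiTW_of_mem_Jt h)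
  rw [← ENNReal.ofReal_toReal (hφ'fin a ha haJ), ← ENNReal.ofReal_toReal hfin]
  change ENNReal.ofReal (ψ a) = ENNReal.ofReal c * ENNReal.ofReal (f a)
  rw [← ENNReal.ofReal_mul hc0, sub_eq_zero.1 (key a ha haJ)]

end SectionData

/-- part 1 of the Main Theorem.  For every semifinite zigzag growth
model `(t, w)` — a semifinite template `t` together with positive weights `w`, one for
each infinite cluster of `t`, summing to `1` — the function `φ_{t,w}` is a strictly
positive, semifinite, indecomposable harmonic function on the graph `Z(t)`. -/
theorem phiTW_is_indecomposable_semifinite_harmonic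
    (t : Template) (hsf : ¬t.IsFiniteTemplate) (D : SectionData t)
    (w : List ℝ) (hlen : w.length = t.numInf)
    (hwpos : ∀ x ∈ w, 0 < x) (hwsum : w.sum = 1) :
    HarmonicOn (Zt t) (phiTW t D w) ∧
    (∀ a ∈ Zt t, 0 < phiTW t D w a) ∧
    SemifiniteOn (Zt t) (phiTW t D w) ∧
    IndecSemifiniteOn (Zt t) (phiTW t D w) := by
  have hW := fun i => weightedFinite_vD (D := D) hlen hwpos i
  have hφ := harmonicOn_phiTW hW ((sum_vD hlen).trans hwsum)
  exact ⟨hφ, fun _ => phiTW_pos hW, semifiniteOn_phiTW hsf hW hφ, indecSemifiniteOn_phiTW hW hφ⟩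

end Zigzag
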